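/- Let (X, λ) be a standard Borel space with an atomless σ-finite measure satisfying λ(X) = ∞, and let T₁, T₂ ∈ Aut(X, λ) be aperiodic. Suppose X = 𝔠₁ ⊔ 𝔡₁ and X = 𝔠₂ ⊔ 𝔡₂ are Hopf decompositions for T₁ and T₂ respectively, with D₁ a fundamental domain for the restriction of T₁ to 𝔡₁ and D₂ a fundamental domain for the restriction of T₂ to 𝔡₂ (where D₁, resp. D₂, is taken to be empty if 𝔡₁, resp. 𝔡₂, is λ-null). Then T₁ and T₂ are λ-approximately conjugate if and only if λ(D₁) = λ(D₂). -/

import Mathlib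

open MeasureTheory Set
open scoped ENNReal

variable {X : Type*}

/-- `T` is aperiodic: almost every point has `T^[n] x ≠ x` for all `n ≥ 1`. -/
def Aperiodic [MeasurableSpace X] (lam : Measure X) (T : X ≃ᵐ X) : Prop :=
  ∀ᵐ x ∂lam, ∀ n : ℕ, 1 ≤ n → (⇑T)^[n] x ≠ x

/-- The restriction of `T` to `Y` is conservative: every positive measure Borel subset of `Y`
has almost all of its points returning to it under some positive iterate of `T`. -/
def ConservativeOn [MeasurableSpace X] (lam : Measure X) (T : X ≃ᵐ X) (Y : Set X) : Prop :=
  ∀ A : Set X, A ⊆ Y → MeasurableSet A → 0 < lam A →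
    ∀ᵐ x ∂lam, x ∈ A → ∃ n : ℕ, 1 ≤ n ∧ (⇑T)^[n] x ∈ A

/-- `D` is a fundamental domain for the restriction of `T` to the invariant set `Y`:
the `ℤ`-translates of `D` are pairwise disjoint and cover `Y` up to a null set. -/
def IsFundDomOn [MeasurableSpace X] (lam : Measure X) (T : X ≃ᵐ X) (Y D : Set X) : Prop :=
  D ⊆ Y ∧
  (Pairwise fun m n : ℤ => Disjoint (⇑(T.toEquiv ^ m) '' D) (⇑(T.toEquiv ^ n) '' D)) ∧
  lam (Y \ ⋃ n : ℤ, ⇑(T.toEquiv ^ n) '' D) = 0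

/-- `T₁` and `T₂` are `λ`-approximately conjugate. -/
def ApproxConj [MeasurableSpace X] (lam : Measure X) (T₁ T₂ : X ≃ᵐ X) : Prop :=
  ∀ ε : ℝ≥0∞, 0 < ε → ∃ S : X ≃ᵐ X, MeasurePreserving (⇑S) lam lam ∧
    lam {x | S (T₁ (S.symm x)) ≠ T₂ x} < ε

namespace AC
open Filter Topology

lemma cdf_continuous (μ : Measure ℝ) [IsFiniteMeasure μ] [NullSingletonClass μ] :
    Continuous (fun x => μ.real (Iic x)) := by
  have h1 : Continuous fun b => ∫ x in (0:ℝ)..b, (1:ℝ) ∂μ :=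
    intervalIntegral.continuous_primitive (fun a b => by simp) 0
  have h2 : (fun x => μ.real (Iic x)) = fun b => μ.real (Iic 0) + ∫ x in (0:ℝ)..b, (1:ℝ) ∂μ := by
    funext b
    rw [← intervalIntegral.integral_Iic_sub_Iic (by simp) (by simp)]
    simp
  rw [h2]
  exact continuous_const.add h1

lemma cdf_surj (μ : Measure ℝ) [IsFiniteMeasure μ] [NullSingletonClass μ] (b : ℝ) (hb : 0 < b)
    (hbm : b < μ.real univ) : ∃ x, μ.real (Iic x) = b := by
  have hc := cdf_continuous μ
  have h1 : Tendsto (fun x => μ.real (Iic x)) atTop (𝓝 (μ.real univ)) :=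
    (ENNReal.tendsto_toReal (measure_ne_top _ _)).comp (tendsto_measure_Iic_atTop μ)
  have h2 : Tendsto (fun x => μ.real (Iic x)) atBot (𝓝 0) := by
    have h3 : Tendsto (fun x : ℝ => μ (Iic x)) atBot (𝓝 (μ (⋂ x : ℝ, Iic x))) :=
      tendsto_measure_iInter_atBot (fun _ => measurableSet_Iic.nullMeasurableSet)
        (fun x y h => Iic_subset_Iic.2 h) ⟨0, measure_ne_top _ _⟩
    have h4 : (⋂ x : ℝ, Iic x) = ∅ := by
      ext y; simp only [mem_iInter, mem_Iic, mem_empty_iff_false, iff_false, not_forall, not_le]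
      exact ⟨y - 1, by linarith⟩
    rw [h4, measure_empty] at h3
    have := (ENNReal.tendsto_toReal (a := 0) (by simp)).comp h3
    simpa using! this
  obtain ⟨x, hx⟩ := (h2.eventually (gt_mem_nhds hb)).exists
  obtain ⟨y, hy⟩ := (h1.eventually (lt_mem_nhds hbm)).exists
  exact mem_range_of_exists_le_of_exists_ge hc ⟨x, hx.le⟩ ⟨y, hy.le⟩

lemma cdf_map (μ : Measure ℝ) [IsFiniteMeasure μ] [NullSingletonClass μ] (s : ℝ) :
    MeasurePreserving (fun x => s + μ.real (Iic x)) μ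
      (volume.restrict (Ico s (s + μ.real univ))) := by
  have hc := cdf_continuous μ
  have hm : Measurable (fun x => s + μ.real (Iic x)) := (continuous_const.add hc).measurable
  refine ⟨hm, ?_⟩
  apply Measure.ext_of_Iic
  intro a
  rw [Measure.map_apply hm measurableSet_Iic, Measure.restrict_apply measurableSet_Iic]
  have hle : ∀ x, μ.real (Iic x) ≤ μ.real univ := fun x => measureReal_mono (subset_univ _)
  have hmono : ∀ x y, x ≤ y → μ.real (Iic x) ≤ μ.real (Iic y) :=
    fun x y h => measureReal_mono (Iic_subset_Iic.2 h)
  have key : μ.real ((fun x => s + μ.real (Iic x)) ⁻¹' Iic a) = max 0 (min (a - s) (μ.real univ)) := by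
    apply le_antisymm
    · rcases lt_or_ge (a - s) 0 with h | h
      · have : ((fun x => s + μ.real (Iic x)) ⁻¹' Iic a) = ∅ := by
          ext x; simp only [mem_preimage, mem_Iic, mem_empty_iff_false, iff_false, not_le]
          have : 0 ≤ μ.real (Iic x) := measureReal_nonneg
          linarith
        rw [this]; simp
      · apply le_max_of_le_right
        apply le_min _ (measureReal_mono (subset_univ _))
        apply le_of_forall_gt
        intro b hb
        rcases lt_or_ge b (μ.real univ) with h' | h'
        · obtain ⟨c, hc1, hc2⟩ := exists_between hb
          obtain ⟨x, hx⟩ := cdf_surj μ c (by linarith) (by linarith)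
          refine lt_of_le_of_lt ?_ hc2
          rw [← hx]
          refine measureReal_mono ?_ (measure_ne_top _ _)
          intro y hy
          simp only [mem_preimage, mem_Iic] at hy ⊢
          by_contra hxy
          have := hmono x y (by linarith)
          linarith
        · rcases lt_or_eq_of_le h' with h'' | h''
          · exact lt_of_le_of_lt (measureReal_mono (subset_univ _)) h''
          · obtain ⟨c, hc1, hc2⟩ := exists_between hb
            obtain ⟨x, hx⟩ := cdf_surj μ c (by linarith) (by linarith)
            refine lt_of_le_of_lt ?_ hc2
            rw [← hx]
            refine measureReal_mono ?_ (measure_ne_top _ _)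
            intro y hy
            simp only [mem_preimage, mem_Iic] at hy ⊢
            by_contra hxy
            have := hmono x y (by linarith)
            linarith
    · apply max_le measureReal_nonneg
      apply le_of_forall_lt
      intro b hb
      rw [lt_min_iff] at hb
      rcases lt_or_ge b 0 with h0 | h0
      · exact lt_of_lt_of_le h0 measureReal_nonneg
      obtain ⟨c, hc1, hc2⟩ := exists_between (lt_min hb.1 hb.2)
      rw [lt_min_iff] at hc2
      obtain ⟨x, hx⟩ := cdf_surj μ c (by linarith) (by linarith)
      refine lt_of_lt_of_le hc1 ?_
      rw [← hx]
      refine measureReal_mono ?_ (measure_ne_top _ _)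
      intro y hy
      simp only [mem_preimage, mem_Iic] at hy ⊢
      have := hmono y x hy
      linarith
  rw [← ENNReal.ofReal_toReal (measure_ne_top μ _), ← measureReal_def, key]
  have hu : 0 ≤ μ.real univ := measureReal_nonneg
  rcases lt_or_ge a s with h | h
  · have : Iic a ∩ Ico s (s + μ.real univ) = ∅ := by
      ext x; simp only [mem_inter_iff, mem_Iic, mem_Ico, mem_empty_iff_false, iff_false]
      rintro ⟨h1, h2, h3⟩; linarith
    rw [this]
    rw [max_eq_left ((min_le_left _ _).trans (by linarith))]; simp
  · rw [max_eq_right (le_min (by linarith) hu)]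
    rcases lt_or_ge a (s + μ.real univ) with h' | h'
    · have : Iic a ∩ Ico s (s + μ.real univ) = Icc s a := by
        ext x; simp only [mem_inter_iff, mem_Iic, mem_Ico, mem_Icc]
        constructor
        · rintro ⟨h1, h2, h3⟩; exact ⟨h2, h1⟩
        · rintro ⟨h1, h2⟩; exact ⟨h2, h1, by linarith⟩
      rw [this, min_eq_left (by linarith)]; simp
    · have : Iic a ∩ Ico s (s + μ.real univ) = Ico s (s + μ.real univ) := by
        apply inter_eq_right.2
        intro x hx; exact (hx.2.le.trans h')
      rw [this, min_eq_right (by linarith)]; simp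

lemma cdf_inj (μ : Measure ℝ) [IsFiniteMeasure μ] [NullSingletonClass μ] :
    ∃ N : Set ℝ, μ N = 0 ∧ InjOn (fun x => μ.real (Iic x)) Nᶜ := by
  let S : ℚ → Set ℝ := fun q => {x | (q:ℝ) < x ∧ μ (Ioc (q:ℝ) x) = 0}
  refine ⟨⋃ q, S q, ?_, ?_⟩
  · rw [measure_iUnion_null_iff]
    intro q
    have hsub : S q ⊆ (⋃ r ∈ {r : ℚ | (r:ℝ) ∈ S q}, Ioc (q:ℝ) r) ∪
        (S q \ (⋃ r ∈ {r : ℚ | (r:ℝ) ∈ S q}, Ioc (q:ℝ) r)) := by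
      intro x hx; by_cases h : x ∈ (⋃ r ∈ {r : ℚ | (r:ℝ) ∈ S q}, Ioc (q:ℝ) r)
      · exact Or.inl h
      · exact Or.inr ⟨hx, h⟩
    apply measure_mono_null hsub
    apply measure_union_null
    · rw [measure_biUnion_null_iff (to_countable _)]
      intro r hr; exact hr.2
    · apply Set.Subsingleton.measure_zero
      have aux : ∀ x y, x ∈ (S q \ (⋃ r ∈ {r : ℚ | (r:ℝ) ∈ S q}, Ioc (q:ℝ) r)) →
        y ∈ (S q \ (⋃ r ∈ {r : ℚ | (r:ℝ) ∈ S q}, Ioc (q:ℝ) r)) → ¬ x < y := by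
        intro x y hx hy hxy
        obtain ⟨r, hr1, hr2⟩ := exists_rat_btwn hxy
        apply hx.2
        have hrS : (r:ℝ) ∈ S q :=
          ⟨hx.1.1.trans hr1, measure_mono_null (Ioc_subset_Ioc_right hr2.le) hy.1.2⟩
        simp only [mem_iUnion]
        exact ⟨r, hrS, hx.1.1, hr1.le⟩
      intro x hx y hy
      exact le_antisymm (not_lt.1 (aux y x hy hx)) (not_lt.1 (aux x y hx hy))
  · have aux : ∀ x y, y ∈ (⋃ q, S q)ᶜ → μ.real (Iic x) = μ.real (Iic y) → ¬ x < y := by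
      intro x y hy h hxy
      apply hy
      obtain ⟨r, hr1, hr2⟩ := exists_rat_btwn hxy
      simp only [mem_iUnion]
      refine ⟨r, hr2, measure_mono_null (Ioc_subset_Ioc_left hr1.le) ?_⟩
      have : μ.real (Ioc x y) = 0 := by
        have e : Ioc x y = Iic y \ Iic x := by ext z; simp [and_comm]
        rw [e, measureReal_sdiff (Iic_subset_Iic.2 hxy.le) measurableSet_Iic]
        simp [h]
      rwa [measureReal_eq_zero_iff] at this
    intro x hx y hy h
    exact le_antisymm (not_lt.1 (aux y x hx h.symm)) (not_lt.1 (aux x y hy h))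

end AC

namespace AC
open Filter Topology

lemma exists_left_inv {Y : Type*} [MeasurableSpace X] [StandardBorelSpace X] [Nonempty X]
    [MeasurableSpace Y] [StandardBorelSpace Y] (μ : Measure X) (f : X → Y) (hf : Measurable f)
    (N : Set X) (hN : μ N = 0) (hinj : InjOn f Nᶜ) :
    ∃ g : Y → X, Measurable g ∧ ∀ᵐ x ∂μ, g (f x) = x := by
  obtain ⟨M, hNM, hM, hM0⟩ := exists_measurable_superset_of_null hN
  have hinj' : InjOn f Mᶜ := hinj.mono (compl_subset_compl.2 hNM)
  have : StandardBorelSpace (Mᶜ : Set X) := hM.compl.standardBorel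
  have hemb : MeasurableEmbedding (Mᶜ.domRestrict f) :=
    (hf.comp measurable_subtype_coe).measurableEmbedding (injOn_iff_injective.1 hinj')
  obtain ⟨g, hg, hgf⟩ := hemb.exists_measurable_extend (measurable_subtype_coe) (fun _ => ‹_›)
  refine ⟨g, hg, ?_⟩
  have : ∀ᵐ x ∂μ, x ∈ Mᶜ := by
    rw [ae_iff]; simpa using hM0
  filter_upwards [this] with x hx
  exact congrFun hgf ⟨x, hx⟩

lemma param [MeasurableSpace X] [StandardBorelSpace X] [Nonempty X]
    (μ : Measure X) [SigmaFinite μ] [NullSingletonClass μ] :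
    ∃ (f : X → ℝ) (g : ℝ → X), Measurable g ∧
      MeasurePreserving f μ (volume.restrict {t : ℝ | 0 ≤ t ∧ ENNReal.ofReal t < μ univ}) ∧
      ∀ᵐ x ∂μ, g (f x) = x := by
  have he : MeasurableEmbedding (embeddingReal X) := measurableEmbedding_embeddingReal X
  let A : ℕ → Set X := disjointed (spanningSets μ)
  have hAm : ∀ n, MeasurableSet (A n) :=
    fun n => MeasurableSet.disjointed (fun i => measurableSet_spanningSets μ i) n
  have hAd : Pairwise (Function.onFun Disjoint A) := disjoint_disjointed _
  have hAu : ⋃ n, A n = univ := by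
    simp only [A]; rw [iUnion_disjointed, iUnion_spanningSets]
  have hAf : ∀ n, μ (A n) < ∞ := fun n =>
    (measure_mono (disjointed_subset _ n)).trans_lt (measure_spanningSets_lt_top μ n)
  let ν : ℕ → Measure ℝ := fun n => (μ.restrict (A n)).map (embeddingReal X)
  have hfin0 : ∀ n, IsFiniteMeasure (μ.restrict (A n)) := fun n => ⟨by simpa using hAf n⟩
  have hfin : ∀ n, IsFiniteMeasure (ν n) := fun n => by dsimp only [ν]; infer_instance
  have hna : ∀ n, NullSingletonClass (ν n) := fun n => ⟨fun t => by
    dsimp only [ν]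
    rw [he.map_apply]
    apply Set.Subsingleton.measure_zero
    intro x hx y hy
    exact he.injective (hx.trans (Eq.symm hy))⟩
  have hνu : ∀ n, (ν n).real univ = μ.real (A n) := fun n => by
    simp only [ν, measureReal_def]
    rw [he.map_apply]; simp
  let s : ℕ → ℝ := fun n => ∑ i ∈ Finset.range n, μ.real (A i)
  have hs : ∀ n, s (n+1) = s n + μ.real (A n) := fun n => Finset.sum_range_succ _ _
  have hsm : Monotone s := monotone_nat_of_le_succ (fun n => by
    rw [hs]; linarith [measureReal_nonneg (μ := μ) (s := A n)])
  let F : ℕ → X → ℝ := fun n x => s n + (ν n).real (Iic (embeddingReal X x))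
  have hFmp : ∀ n, MeasurePreserving (F n) (μ.restrict (A n))
      (volume.restrict (Ico (s n) (s (n+1)))) := fun n => by
    have h1 := cdf_map (ν n) (s n)
    rw [hνu, ← hs] at h1
    exact h1.comp ⟨he.measurable, rfl⟩
  obtain ⟨f, hf, hfF⟩ := exists_measurable_piecewise A hAm F (fun n => (hFmp n).measurable)
    (fun i j hij => by
      change EqOn _ _ (A i ∩ A j)
      rw [(hAd hij).inter_eq]; exact eqOn_empty _ _)
  have hfmp : ∀ n, MeasurePreserving f (μ.restrict (A n))
      (volume.restrict (Ico (s n) (s (n+1)))) := fun n => by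
    refine ⟨hf, ?_⟩
    rw [← (hFmp n).map_eq]
    apply Measure.map_congr
    filter_upwards [ae_restrict_mem (hAm n)] with x hx using hfF n hx
  have hId : Pairwise (Function.onFun Disjoint fun n => Ico (s n) (s (n+1))) :=
    hsm.pairwise_disjoint_on_Ico_succ
  have hI : (⋃ n, Ico (s n) (s (n+1))) = {t : ℝ | 0 ≤ t ∧ ENNReal.ofReal t < μ univ} := by
    have hsE : ∀ n, ENNReal.ofReal (s n) = ∑ i ∈ Finset.range n, μ (A i) := fun n => by
      rw [ENNReal.ofReal_sum_of_nonneg (fun i _ => measureReal_nonneg)]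
      exact Finset.sum_congr rfl (fun i _ => by
        rw [measureReal_def, ENNReal.ofReal_toReal (hAf i).ne])
    have hsU : μ univ = ∑' i, μ (A i) := by
      rw [← hAu, measure_iUnion hAd hAm]
    have hs0 : s 0 = 0 := by simp [s]
    ext t
    simp only [mem_iUnion, mem_Ico, mem_ofPred_eq]
    constructor
    · rintro ⟨n, h1, h2⟩
      have h0 : 0 ≤ s n := hs0 ▸ hsm (Nat.zero_le n)
      refine ⟨h0.trans h1, ?_⟩
      rw [hsU]
      refine lt_of_lt_of_le ((ENNReal.ofReal_lt_ofReal_iff (by linarith)).2 h2) ?_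
      rw [hsE]
      exact ENNReal.sum_le_tsum _
    · rintro ⟨h0, h1⟩
      rw [hsU, ENNReal.tsum_eq_iSup_nat, lt_iSup_iff] at h1
      have h2 : ∃ n, t < s n := by
        obtain ⟨n, hn⟩ := h1
        rw [← hsE] at hn
        exact ⟨n, (ENNReal.ofReal_lt_ofReal_iff_of_nonneg h0).1 hn⟩
      classical
      have h3 := Nat.find_spec h2
      have h4 : Nat.find h2 ≠ 0 := by
        intro h; rw [h, hs0] at h3; linarith
      obtain ⟨m, hm⟩ := Nat.exists_eq_succ_of_ne_zero h4
      refine ⟨m, ?_, ?_⟩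
      · exact not_lt.1 (Nat.find_min h2 (m := m) (by omega))
      · rw [hm] at h3; exact h3
  have hMP : MeasurePreserving f μ
      (volume.restrict {t : ℝ | 0 ≤ t ∧ ENNReal.ofReal t < μ univ}) := by
    refine ⟨hf, ?_⟩
    have e1 : μ = Measure.sum (fun n => μ.restrict (A n)) := by
      rw [← Measure.restrict_iUnion hAd hAm, hAu, Measure.restrict_univ]
    rw [← hI, Measure.restrict_iUnion hId (fun n => measurableSet_Ico)]
    conv_lhs => rw [e1]
    rw [Measure.map_sum hf.aemeasurable]
    congr 1
    funext n
    exact (hfmp n).map_eq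
  choose N hN0 hNinj using fun n => cdf_inj (ν n)
  -- good set
  have hae : ∀ᵐ x ∂μ, ∀ n, x ∈ A n → (f x ∈ Ico (s n) (s (n+1)) ∧ embeddingReal X x ∉ N n) := by
    rw [ae_all_iff]
    intro n
    rw [← ae_restrict_iff' (hAm n)]
    have h1 : ∀ᵐ x ∂(μ.restrict (A n)), f x ∈ Ico (s n) (s (n+1)) :=
      (hfmp n).quasiMeasurePreserving.ae (ae_restrict_mem measurableSet_Ico)
    have h2 : ∀ᵐ x ∂(μ.restrict (A n)), embeddingReal X x ∉ N n := by
      have : ∀ᵐ t ∂(ν n), t ∉ N n := by rw [ae_iff]; simpa using hN0 n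
      exact ae_of_ae_map he.measurable.aemeasurable this
    filter_upwards [h1, h2] with x a b using ⟨a, b⟩
  obtain ⟨g, hg, hgf⟩ := exists_left_inv μ f hf _ (ae_iff.1 hae) (by
    intro x hx y hy hxy
    simp only [mem_compl_iff, mem_ofPred_eq, not_not] at hx hy
    obtain ⟨n, hn⟩ := mem_iUnion.1 (hAu ▸ mem_univ x)
    obtain ⟨m, hm⟩ := mem_iUnion.1 (hAu ▸ mem_univ y)
    have hnm : n = m := by
      by_contra hne
      have := hId hne
      exact (Set.disjoint_left.1 this) (hx n hn).1 (hxy ▸ (hy m hm).1)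
    subst hnm
    have h1 := hfF n hn
    have h2 := hfF n hm
    rw [h1, h2] at hxy
    simp only [F, add_right_inj] at hxy
    exact he.injective (hNinj n (hx n hn).2 (hy n hm).2 hxy))
  exact ⟨f, g, hg, hMP, hgf⟩

lemma iso [MeasurableSpace X] [StandardBorelSpace X] [Nonempty X]
    (μ ν : Measure X) [SigmaFinite μ] [NullSingletonClass μ] [SigmaFinite ν] [NullSingletonClass ν]
    (h : μ univ = ν univ) :
    ∃ (f g : X → X), Measurable g ∧ MeasurePreserving f μ ν ∧ ∀ᵐ x ∂μ, g (f x) = x := by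
  obtain ⟨f1, g1, hg1, hf1, h1⟩ := param μ
  obtain ⟨f2, g2, hg2, hf2, h2⟩ := param ν
  rw [← h] at hf2
  have hg2mp : MeasurePreserving g2
    (volume.restrict {t : ℝ | 0 ≤ t ∧ ENNReal.ofReal t < μ univ}) ν := by
    refine ⟨hg2, ?_⟩
    rw [← hf2.map_eq, Measure.map_map hg2 hf2.measurable]
    conv_rhs => rw [← Measure.map_id (μ := ν)]
    exact Measure.map_congr h2
  have h3 : ∀ᵐ t ∂(volume.restrict {t : ℝ | 0 ≤ t ∧ ENNReal.ofReal t < μ univ}), f2 (g2 t) = t := by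
    rw [← hf2.map_eq]
    refine (ae_map_iff hf2.measurable.aemeasurable
      (measurableSet_eq_fun (hf2.measurable.comp hg2) measurable_id)).2 ?_
    filter_upwards [h2] with x hx
    simp [hx]
  refine ⟨g2 ∘ f1, g1 ∘ f2, hg1.comp hf2.measurable, hg2mp.comp hf1, ?_⟩
  filter_upwards [h1, hf1.quasiMeasurePreserving.ae h3] with x hx hx3
  simp only [Function.comp]
  rw [hx3, hx]

end AC

namespace AC
open Filter Topology

lemma not_countable [MeasurableSpace X] (lam : Measure X) [NullSingletonClass lam]
    (hX : lam univ ≠ 0) : ¬ Countable X := by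
  intro h
  exact hX ((Set.countable_univ).measure_zero lam)

lemma exists_null_uncountable [MeasurableSpace X] [StandardBorelSpace X]
    (lam : Measure X) [SigmaFinite lam] [NullSingletonClass lam] (hX : lam univ ≠ 0) :
    ∃ K : Set X, MeasurableSet K ∧ lam K = 0 ∧ ¬ K.Countable := by
  have hnc := not_countable lam hX
  have hR : ¬ Countable (ℝ × ℝ) := by
    intro h
    exact (not_countable_iff.2 (inferInstance : Uncountable ℝ)) (Function.Injective.countable (f := fun t : ℝ => (t, t))
      (fun a b h => (Prod.ext_iff.1 h).1))
  let e : X ≃ᵐ ℝ × ℝ := PolishSpace.measurableEquivOfNotCountable hnc hR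
  have hm : Measurable (fun x => (e x).1) := measurable_fst.comp e.measurable
  have hc := Measure.countable_meas_level_set_pos (μ := lam) hm
  obtain ⟨t, ht⟩ : ∃ t, t ∉ {t : ℝ | 0 < lam {a | (e a).1 = t}} := by
    by_contra h
    push Not at h
    have : {t : ℝ | 0 < lam {a | (e a).1 = t}} = univ := eq_univ_of_forall h
    rw [this] at hc
    exact not_countable_univ hc
  refine ⟨{a | (e a).1 = t}, measurableSet_eq_fun hm measurable_const, by simpa using ht, ?_⟩
  intro hK
  have h2 := hK.image (fun x => (e x).2)
  have : (fun x => (e x).2) '' {a | (e a).1 = t} = univ := by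
    apply eq_univ_of_forall
    intro r
    exact ⟨e.symm (t, r), by simp, by simp⟩
  rw [this] at h2
  exact not_countable_univ h2

lemma ext_aut [MeasurableSpace X] [StandardBorelSpace X]
    (lam : Measure X) [SigmaFinite lam] [NullSingletonClass lam] (hX : lam univ ≠ 0)
    (g G : X → X) (hG : Measurable G) (hg : MeasurePreserving g lam lam)
    (h : ∀ᵐ x ∂lam, G (g x) = x) :
    ∃ S : X ≃ᵐ X, MeasurePreserving S lam lam ∧ ∀ᵐ x ∂lam, S x = g x := by
  classical
  obtain ⟨K, hKm, hK0, hKc⟩ := exists_null_uncountable lam hX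
  let X1 : Set X := {x | G (g x) = x} \ (K ∪ g ⁻¹' K)
  have hX1m : MeasurableSet X1 :=
    (measurableSet_eq_fun (hG.comp hg.measurable) measurable_id).diff
      (hKm.union (hg.measurable hKm))
  have hX1 : ∀ᵐ x ∂lam, x ∈ X1 := by
    have hK' : ∀ᵐ x ∂lam, x ∉ K := by rw [ae_iff]; simpa using hK0
    filter_upwards [h, hK', hg.quasiMeasurePreserving.ae hK'] with x h1 h2 h3
    exact ⟨h1, fun h => h.elim h2 h3⟩
  have hinj : InjOn g X1 := by
    intro x hx y hy hxy
    have h1 : G (g x) = x := hx.1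
    have h2 : G (g y) = y := hy.1
    rw [← h1, ← h2, hxy]
  have hY1m : MeasurableSet (g '' X1) := hX1m.image_of_measurable_injOn hg.measurable hinj
  have : StandardBorelSpace X1 := hX1m.standardBorel
  have : StandardBorelSpace (X1ᶜ : Set X) := hX1m.compl.standardBorel
  have : StandardBorelSpace ((g '' X1)ᶜ : Set X) := hY1m.compl.standardBorel
  have hc1 : ¬ Countable (X1ᶜ : Set X) := fun hc =>
    hKc ((Set.countable_coe_iff.1 hc).mono (by
      intro x hx hx1
      exact hx1.2 (Or.inl hx)))
  have hc2 : ¬ Countable ((g '' X1)ᶜ : Set X) := fun hc =>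
    hKc ((Set.countable_coe_iff.1 hc).mono (by
      rintro x hx ⟨y, hy, rfl⟩
      exact hy.2 (Or.inr hx)))
  let e2 : (X1ᶜ : Set X) ≃ᵐ ((g '' X1)ᶜ : Set X) := PolishSpace.measurableEquivOfNotCountable hc1 hc2
  have hGm : ∀ y ∈ g '' X1, G y ∈ X1 := by
    rintro _ ⟨x, hx, rfl⟩
    rw [show G (g x) = x from hx.1]; exact hx
  let e1 : X1 ≃ᵐ (g '' X1) :=
    { toFun := fun x => ⟨g x, mem_image_of_mem g x.2⟩
      invFun := fun y => ⟨G y, hGm y y.2⟩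
      left_inv := fun x => Subtype.ext x.2.1
      right_inv := fun y => by
        obtain ⟨y, x, hx, rfl⟩ := y
        apply Subtype.ext
        exact congrArg g hx.1
      measurable_toFun := (hg.measurable.comp measurable_subtype_coe).subtype_mk
      measurable_invFun := (hG.comp measurable_subtype_coe).subtype_mk (h := fun y => hGm y y.2) }
  let S : X ≃ᵐ X := (MeasurableEquiv.sumCompl hX1m).symm.trans
    ((MeasurableEquiv.sumCongr e1 e2).trans (MeasurableEquiv.sumCompl hY1m))
  have hS : ∀ x ∈ X1, S x = g x := by
    intro x hx
    have h1 : (MeasurableEquiv.sumCompl hX1m).symm x = Sum.inl ⟨x, hx⟩ := by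
      rw [MeasurableEquiv.symm_apply_eq]; rfl
    change (MeasurableEquiv.sumCompl hY1m) ((MeasurableEquiv.sumCongr e1 e2)
      ((MeasurableEquiv.sumCompl hX1m).symm x)) = g x
    rw [h1]; rfl
  have hSg : ∀ᵐ x ∂lam, S x = g x := by
    filter_upwards [hX1] with x hx using hS x hx
  refine ⟨S, ⟨S.measurable, ?_⟩, hSg⟩
  rw [Measure.map_congr hSg, hg.map_eq]

lemma glue [MeasurableSpace X] [StandardBorelSpace X]
    (lam : Measure X) [SigmaFinite lam] [NullSingletonClass lam] (hX : lam univ ≠ 0)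
    {ι : Type*} [Countable ι] [Nonempty ι] (U V : ι → Set X) (hUm : ∀ i, MeasurableSet (U i))
    (hVm : ∀ i, MeasurableSet (V i)) (hUd : Pairwise (Function.onFun Disjoint U))
    (hVd : Pairwise (Function.onFun Disjoint V)) (hU : ∀ᵐ x ∂lam, ∃ i, x ∈ U i)
    (hV : ∀ᵐ x ∂lam, ∃ i, x ∈ V i)
    (φ ψ : ι → X → X) (hψ : ∀ i, Measurable (ψ i)) 
    (hφ : ∀ i, Measurable (φ i))
    (hmp : ∀ i, MeasurePreserving (φ i) (lam.restrict (U i)) (lam.restrict (V i)))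
    (hinv : ∀ i, ∀ᵐ x ∂(lam.restrict (U i)), ψ i (φ i x) = x) :
    ∃ S : X ≃ᵐ X, MeasurePreserving S lam lam ∧ ∀ᵐ x ∂lam, ∀ i, x ∈ U i → S x = φ i x := by
  obtain ⟨g, hg, hgφ⟩ := exists_measurable_piecewise U hUm φ hφ
    (fun i j hij => by
      change EqOn _ _ (U i ∩ U j)
      rw [(hUd hij).inter_eq]; exact eqOn_empty _ _)
  obtain ⟨G, hG, hGψ⟩ := exists_measurable_piecewise V hVm ψ hψ
    (fun i j hij => by
      change EqOn _ _ (V i ∩ V j)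
      rw [(hVd hij).inter_eq]; exact eqOn_empty _ _)
  have hsum : ∀ W : ι → Set X, (∀ i, MeasurableSet (W i)) → Pairwise (Function.onFun Disjoint W) →
      (∀ᵐ x ∂lam, ∃ i, x ∈ W i) → lam = Measure.sum (fun i => lam.restrict (W i)) := by
    intro W h1 h2 h3
    rw [← Measure.restrict_iUnion h2 h1]
    symm
    apply Measure.restrict_eq_self_of_ae_mem
    filter_upwards [h3] with x hx using mem_iUnion.2 hx
  have hgmp : MeasurePreserving g lam lam := by
    refine ⟨hg, ?_⟩
    conv_lhs => rw [hsum U hUm hUd hU]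
    conv_rhs => rw [hsum V hVm hVd hV]
    rw [Measure.map_sum hg.aemeasurable]
    congr 1
    funext i
    rw [← (hmp i).map_eq]
    apply Measure.map_congr
    filter_upwards [ae_restrict_mem (hUm i)] with x hx using hgφ i hx
  have hGg : ∀ᵐ x ∂lam, G (g x) = x := by
    have h1 : ∀ᵐ x ∂lam, ∀ i, x ∈ U i → G (g x) = x := by
      rw [ae_all_iff]; intro i
      rw [← ae_restrict_iff' (hUm i)]
      filter_upwards [ae_restrict_mem (hUm i), hinv i,
        (hmp i).quasiMeasurePreserving.ae (ae_restrict_mem (hVm i))] with x h1 h2 h3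
      rw [hgφ i h1, hGψ i h3, h2]
    filter_upwards [h1, hU] with x h2 ⟨i, hi⟩ using h2 i hi
  obtain ⟨S, hS, hSg⟩ := ext_aut lam hX g G hG hgmp hGg
  refine ⟨S, hS, ?_⟩
  filter_upwards [hSg] with x hx i hi
  rw [hx, hgφ i hi]

end AC

namespace AC
open Filter Topology

def zp [MeasurableSpace X] (T : X ≃ᵐ X) (n : ℤ) : X → X := ⇑(T.toEquiv ^ n)

section zp
variable [MeasurableSpace X] (T : X ≃ᵐ X)

lemma zp_zero (x : X) : zp T 0 x = x := rfl

lemma zp_add (m n : ℤ) (x : X) : zp T (m + n) x = zp T m (zp T n x) := by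
  unfold zp; rw [zpow_add]; rfl

lemma zp_one (x : X) : zp T 1 x = T x := by
  unfold zp; rw [zpow_one]; rfl

lemma zp_succ (n : ℤ) (x : X) : zp T (n + 1) x = T (zp T n x) := by
  rw [add_comm, zp_add, zp_one]

lemma zp_succ' (n : ℤ) (x : X) : zp T (n + 1) x = zp T n (T x) := by
  rw [zp_add, zp_one]

lemma zp_neg_zp (n : ℤ) (x : X) : zp T (-n) (zp T n x) = x := by
  rw [← zp_add, neg_add_cancel, zp_zero]

lemma zp_zp_neg (n : ℤ) (x : X) : zp T n (zp T (-n) x) = x := by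
  rw [← zp_add, add_neg_cancel, zp_zero]

lemma zp_inj (n : ℤ) {x y : X} (h : zp T n x = zp T n y) : x = y :=
  (T.toEquiv ^ n).injective h

lemma zp_nat (n : ℕ) (x : X) : zp T n x = (⇑T)^[n] x := by
  induction n with
  | zero => rfl
  | succ n ih => rw [Function.iterate_succ_apply', ← ih, Nat.cast_succ, zp_succ]

lemma zp_neg_one (x : X) : zp T (-1) x = T.symm x := by
  apply T.injective
  rw [T.apply_symm_apply, ← zp_one T (zp T (-1) x), zp_zp_neg]

lemma zp_neg_nat (n : ℕ) (x : X) : zp T (-n) x = (⇑T.symm)^[n] x := by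
  induction n with
  | zero => rfl
  | succ n ih =>
    rw [Function.iterate_succ_apply', ← ih, Nat.cast_succ, neg_add_rev, zp_add, zp_neg_one]

lemma zp_measurable (n : ℤ) : Measurable (zp T n) := by
  obtain ⟨m, rfl | rfl⟩ := n.eq_nat_or_neg
  · rw [funext (zp_nat T m)]; exact T.measurable.iterate m
  · rw [funext (zp_neg_nat T m)]; exact T.symm.measurable.iterate m

lemma zp_mp {lam : Measure X} (hT : MeasurePreserving T lam lam) (n : ℤ) :
    MeasurePreserving (zp T n) lam lam := by
  obtain ⟨m, rfl | rfl⟩ := n.eq_nat_or_neg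
  · rw [funext (zp_nat T m)]; exact hT.iterate m
  · rw [funext (zp_neg_nat T m)]; exact (hT.symm T).iterate m

lemma zp_image (n : ℤ) (A : Set X) : zp T n '' A = zp T (-n) ⁻¹' A := by
  ext x; constructor
  · rintro ⟨y, hy, rfl⟩
    change zp T (-n) (zp T n y) ∈ A
    rwa [zp_neg_zp]
  · intro hx
    exact ⟨zp T (-n) x, hx, zp_zp_neg T n x⟩

lemma ae_zp {lam : Measure X} (hT : MeasurePreserving T lam lam) {p : X → Prop}
    (h : ∀ᵐ x ∂lam, p x) : ∀ᵐ x ∂lam, ∀ n : ℤ, p (zp T n x) := by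
  rw [ae_all_iff]; intro n
  exact (zp_mp T hT n).quasiMeasurePreserving.ae h

end zp

def Cl [MeasurableSpace X] (lam : Measure X) (T₁ T₂ : X ≃ᵐ X) (ε : ℝ≥0∞) : Prop :=
  ∃ S : X ≃ᵐ X, MeasurePreserving S lam lam ∧ lam {y | S (T₁ y) ≠ T₂ (S y)} ≤ ε

section Cl
variable [MeasurableSpace X] {lam : Measure X} {T₁ T₂ T₃ : X ≃ᵐ X}

lemma cl_near {ε : ℝ≥0∞} (h : lam {x | T₁ x ≠ T₂ x} ≤ ε) : Cl lam T₁ T₂ ε :=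
  ⟨MeasurableEquiv.refl X, MeasurePreserving.id lam, h⟩

lemma meas_eq {S : X ≃ᵐ X} (hS : MeasurePreserving S lam lam) :
    lam {x | S (T₁ (S.symm x)) ≠ T₂ x} = lam {y | S (T₁ y) ≠ T₂ (S y)} := by
  have : {y | S (T₁ y) ≠ T₂ (S y)} = S ⁻¹' {x | S (T₁ (S.symm x)) ≠ T₂ x} := by
    ext y; simp
  rw [this, hS.measure_preimage_equiv]

lemma approxConj_of_cl (h : ∀ ε : ℝ≥0∞, 0 < ε → Cl lam T₁ T₂ ε) : ApproxConj lam T₁ T₂ := by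
  intro ε hε
  obtain ⟨δ, hδ, hδε⟩ := exists_between hε
  obtain ⟨S, hS, h1⟩ := h δ hδ
  refine ⟨S, hS, ?_⟩
  rw [meas_eq hS]
  exact h1.trans_lt hδε

lemma cl_of_approxConj (h : ApproxConj lam T₁ T₂) (ε : ℝ≥0∞) (hε : 0 < ε) : Cl lam T₁ T₂ ε := by
  obtain ⟨S, hS, h1⟩ := h ε hε
  rw [meas_eq hS] at h1
  exact ⟨S, hS, h1.le⟩

lemma Cl.symm {ε : ℝ≥0∞} (h : Cl lam T₁ T₂ ε) : Cl lam T₂ T₁ ε := by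
  obtain ⟨S, hS, h1⟩ := h
  refine ⟨S.symm, hS.symm S, ?_⟩
  refine le_trans (le_of_eq ?_) h1
  have : {y | S (T₁ y) ≠ T₂ (S y)} = S ⁻¹' {y | S.symm (T₂ y) ≠ T₁ (S.symm y)} := by
    ext y
    simp only [mem_preimage, mem_ofPred_eq, MeasurableEquiv.symm_apply_apply, ne_eq, not_iff_not]
    rw [S.symm_apply_eq]
    exact eq_comm
  rw [this, hS.measure_preimage_equiv]

lemma Cl.trans {a b : ℝ≥0∞} (h : Cl lam T₁ T₂ a) (h' : Cl lam T₂ T₃ b) :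
    Cl lam T₁ T₃ (a + b) := by
  obtain ⟨S, hS, h1⟩ := h
  obtain ⟨R, hR, h2⟩ := h'
  refine ⟨S.trans R, hR.comp hS, ?_⟩
  have : {y | (S.trans R) (T₁ y) ≠ T₃ ((S.trans R) y)} ⊆ {y | S (T₁ y) ≠ T₂ (S y)} ∪
      S ⁻¹' {y | R (T₂ y) ≠ T₃ (R y)} := by
    intro y hy
    by_contra hn
    simp only [mem_union, mem_preimage, mem_ofPred_eq, not_or, not_not] at hn
    apply hy
    change R (S (T₁ y)) = T₃ (R (S y))
    rw [hn.1, hn.2]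
  calc _ ≤ _ := measure_mono this
    _ ≤ _ := measure_union_le _ _
    _ ≤ a + b := by
      rw [hS.measure_preimage_equiv]
      exact add_le_add h1 h2

end Cl

theorem tower [MeasurableSpace X] [StandardBorelSpace X]
    (lam : Measure X) [SigmaFinite lam] [NullSingletonClass lam] (hX : lam univ ≠ 0)
    (T₁ T₂ : X ≃ᵐ X) (hT₁ : MeasurePreserving T₁ lam lam) (hT₂ : MeasurePreserving T₂ lam lam)
    {K : Type*} [Countable K] (J : K → Set ℤ) (F₁ F₂ : K → Set X)
    (hm₁ : ∀ k, MeasurableSet (F₁ k)) (hm₂ : ∀ k, MeasurableSet (F₂ k))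
    (hF : ∀ k, lam (F₁ k) = lam (F₂ k))
    (hd₁ : ∀ k j k' j', j ∈ J k → j' ∈ J k' → ∀ x, zp T₁ (-j) x ∈ F₁ k → zp T₁ (-j') x ∈ F₁ k' →
      (k, j) = (k', j'))
    (hd₂ : ∀ k j k' j', j ∈ J k → j' ∈ J k' → ∀ x, zp T₂ (-j) x ∈ F₂ k → zp T₂ (-j') x ∈ F₂ k' →
      (k, j) = (k', j'))
    (hc₁ : ∀ᵐ x ∂lam, ∃ k, ∃ j ∈ J k, zp T₁ (-j) x ∈ F₁ k)
    (hc₂ : ∀ᵐ x ∂lam, ∃ k, ∃ j ∈ J k, zp T₂ (-j) x ∈ F₂ k) :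
    ∃ S : X ≃ᵐ X, MeasurePreserving S lam lam ∧ ∀ᵐ x ∂lam, ∀ k j, j ∈ J k → j + 1 ∈ J k →
      zp T₁ (-j) x ∈ F₁ k → S (T₁ x) = T₂ (S x) := by
  have hne : NeZero lam := ⟨fun h => hX (by simp [h])⟩
  obtain ⟨x₀, k₀, j₀, hj₀, -⟩ := hc₁.exists
  have hXne : Nonempty X := ⟨x₀⟩
  have hiso : ∀ k, ∃ (f g : X → X), Measurable g ∧ MeasurePreserving f (lam.restrict (F₁ k))
    (lam.restrict (F₂ k)) ∧ ∀ᵐ x ∂(lam.restrict (F₁ k)), g (f x) = x := fun k =>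
    iso _ _ (by simpa using hF k)
  choose f g hg hf hgf using hiso
  let ι := {p : K × ℤ // p.2 ∈ J p.1}
  have hι : Nonempty ι := ⟨⟨(k₀, j₀), hj₀⟩⟩
  have hmpd : ∀ k j, MeasurePreserving (zp T₁ (-j)) (lam.restrict (zp T₁ (-j) ⁻¹' F₁ k))
      (lam.restrict (F₁ k)) := fun k j => (zp_mp T₁ hT₁ (-j)).restrict_preimage (hm₁ k)
  obtain ⟨S, hS, hSφ⟩ := glue lam hX (ι := ι)
    (fun i => zp T₁ (-i.1.2) ⁻¹' F₁ i.1.1) (fun i => zp T₂ (-i.1.2) ⁻¹' F₂ i.1.1)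
    (fun i => zp_measurable _ _ (hm₁ _)) (fun i => zp_measurable _ _ (hm₂ _))
    (fun i i' hii => by
      apply Set.disjoint_left.2
      intro x hx hx'
      exact hii (Subtype.ext (hd₁ _ _ _ _ i.2 i'.2 x hx hx')))
    (fun i i' hii => by
      apply Set.disjoint_left.2
      intro x hx hx'
      exact hii (Subtype.ext (hd₂ _ _ _ _ i.2 i'.2 x hx hx')))
    (by filter_upwards [hc₁] with x ⟨k, j, hj, hx⟩ using ⟨⟨(k, j), hj⟩, hx⟩)
    (by filter_upwards [hc₂] with x ⟨k, j, hj, hx⟩ using ⟨⟨(k, j), hj⟩, hx⟩)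
    (fun i x => zp T₂ i.1.2 (f i.1.1 (zp T₁ (-i.1.2) x)))
    (fun i x => zp T₁ i.1.2 (g i.1.1 (zp T₂ (-i.1.2) x)))
    (fun i => (zp_measurable _ _).comp ((hg _).comp (zp_measurable _ _)))
    (fun i => (zp_measurable _ _).comp ((hf _).measurable.comp (zp_measurable _ _)))
    (fun i => by
      have h1 := hmpd i.1.1 i.1.2
      have h2 : MeasurePreserving (zp T₂ i.1.2) (lam.restrict (F₂ i.1.1))
          (lam.restrict (zp T₂ (-i.1.2) ⁻¹' F₂ i.1.1)) := by
        have := (zp_mp T₂ hT₂ i.1.2).restrict_preimage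
          (zp_measurable T₂ (-i.1.2) (hm₂ i.1.1))
        have e : zp T₂ i.1.2 ⁻¹' (zp T₂ (-i.1.2) ⁻¹' F₂ i.1.1) = F₂ i.1.1 := by
          ext x; simp only [mem_preimage, zp_neg_zp]
        rwa [e] at this
      exact h2.comp ((hf _).comp h1))
    (fun i => by
      filter_upwards [(hmpd i.1.1 i.1.2).quasiMeasurePreserving.ae (hgf i.1.1)] with x hx
      rw [zp_neg_zp, hx, zp_zp_neg])
  refine ⟨S, hS, ?_⟩
  filter_upwards [hSφ, hT₁.quasiMeasurePreserving.ae hSφ] with x h1 h2 k j hj hj1 hx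
  have e : zp T₁ (-(j+1)) (T₁ x) = zp T₁ (-j) x := by
    rw [← zp_succ']; congr 1; ring
  have h3 := h1 ⟨(k, j), hj⟩ hx
  have h4 := h2 ⟨(k, j+1), hj1⟩ (by
    change zp T₁ (-(j+1)) (T₁ x) ∈ F₁ k
    rwa [e])
  simp only at h3 h4
  rw [h3, h4, e, zp_succ]

end AC

namespace AC
open Filter Topology

section P5
variable [MeasurableSpace X] {lam : Measure X}

def Wand (T : X ≃ᵐ X) (W : Set X) : Prop := ∀ x n m, zp T n x ∈ W → zp T m x ∈ W → n = m

lemma Wand.sum_le {T : X ≃ᵐ X} (hT : MeasurePreserving T lam lam) {W : Set X} (hw : Wand T W)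
    (hW : MeasurableSet W) {B : Set X} (hB : MeasurableSet B) :
    ∑' n : ℤ, lam (W ∩ zp T n ⁻¹' B) ≤ lam B := by
  have e : ∀ n : ℤ, lam (W ∩ zp T n ⁻¹' B) = lam (zp T (-n) ⁻¹' W ∩ B) := by
    intro n
    rw [← (zp_mp T hT (-n)).measure_preimage (hW.inter (zp_measurable T n hB)).nullMeasurableSet]
    congr 1
    ext x
    simp only [mem_preimage, mem_inter_iff, zp_zp_neg]
  simp_rw [e]
  rw [← measure_iUnion]
  · exact measure_mono (iUnion_subset fun n => inter_subset_right)
  · intro m n hmn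
    apply Set.disjoint_left.2
    intro x hx hx'
    exact hmn (neg_injective (hw x _ _ hx.1 hx'.1))
  · intro n; exact (zp_measurable T _ hW).inter hB

lemma Wand.mono {T : X ≃ᵐ X} {W V : Set X} (hw : Wand T W) (h : V ⊆ W) : Wand T V :=
  fun x n m h1 h2 => hw x n m (h h1) (h h2)

lemma wand_null {T : X ≃ᵐ X} {W c : Set X} (hcons : ConservativeOn lam T c) (hw : Wand T W)
    (hW : MeasurableSet W) (hWc : W ⊆ c) : lam W = 0 := by
  by_contra h
  have h1 := hcons W hWc hW (pos_iff_ne_zero.2 h)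
  apply h
  rw [measure_eq_zero_iff_ae_notMem]
  filter_upwards [h1] with x hx hxW
  obtain ⟨n, hn, hn'⟩ := hx hxW
  have := hw x 0 n hxW (by rwa [zp_nat])
  omega

lemma fd_wand {T : X ≃ᵐ X} {d D : Set X} (hfd : IsFundDomOn lam T d D) : Wand T D := by
  intro x n m h1 h2
  by_contra hnm
  have := hfd.2.1 (i := -n) (j := -m) (fun h => hnm (by omega))
  change Disjoint (zp T _ '' D) (zp T _ '' D) at this
  rw [zp_image, zp_image] at this
  have h1 : x ∈ zp T (- -n) ⁻¹' D := by simpa using h1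
  have h2 : x ∈ zp T (- -m) ⁻¹' D := by simpa using h2
  exact Set.disjoint_left.1 this h1 h2

lemma fd_cover {T : X ≃ᵐ X} {d D : Set X} (hfd : IsFundDomOn lam T d D) :
    ∀ᵐ x ∂lam, x ∈ d → ∃ n : ℤ, zp T n x ∈ D := by
  have h := hfd.2.2
  rw [measure_eq_zero_iff_ae_notMem] at h
  filter_upwards [h] with x hx hxd
  by_contra hn
  push Not at hn
  apply hx
  refine ⟨hxd, ?_⟩
  rw [mem_iUnion]
  rintro ⟨n, hn'⟩
  change x ∈ zp T n '' D at hn'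
  rw [zp_image] at hn'
  exact hn _ hn'

lemma wand_le {T : X ≃ᵐ X} (hT : MeasurePreserving T lam lam) {c d D W : Set X}
    (hc : MeasurableSet c) (hD : MeasurableSet D)
    (hcover : c ∪ d = univ) (hcons : ConservativeOn lam T c) (hfd : IsFundDomOn lam T d D)
    (hw : Wand T W) (hW : MeasurableSet W) : lam W ≤ lam D := by
  have h0 : lam (W ∩ c) = 0 := wand_null hcons (hw.mono inter_subset_left) (hW.inter hc)
    inter_subset_right
  have h1 : lam W ≤ lam ((W ∩ c) ∪ ⋃ n : ℤ, W ∩ zp T n ⁻¹' D) := by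
    apply measure_mono_ae
    filter_upwards [fd_cover hfd] with x hx hxW
    have hxW : x ∈ W := hxW
    change x ∈ ((W ∩ c) ∪ ⋃ n : ℤ, W ∩ zp T n ⁻¹' D)
    rcases (hcover ▸ mem_univ x : x ∈ c ∪ d) with h | h
    · exact Or.inl ⟨hxW, h⟩
    · obtain ⟨n, hn⟩ := hx h
      exact Or.inr (mem_iUnion.2 ⟨n, hxW, hn⟩)
  calc lam W ≤ _ := h1
    _ ≤ lam (W ∩ c) + lam (⋃ n : ℤ, W ∩ zp T n ⁻¹' D) := measure_union_le _ _
    _ ≤ 0 + ∑' n : ℤ, lam (W ∩ zp T n ⁻¹' D) := by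
      rw [h0]; gcongr; exact measure_iUnion_le _
    _ ≤ lam D := by rw [zero_add]; exact hw.sum_le hT hW hD

lemma forward_le [StandardBorelSpace X] {T₁ T₂ : X ≃ᵐ X} (hT₁ : MeasurePreserving T₁ lam lam)
    (hT₂ : MeasurePreserving T₂ lam lam) {d₁ D₁ c₂ d₂ D₂ : Set X}
    (hD₁ : MeasurableSet D₁) (hfd₁ : IsFundDomOn lam T₁ d₁ D₁)
    (hc : MeasurableSet c₂) (hD : MeasurableSet D₂)
    (hcover : c₂ ∪ d₂ = univ) (hcons : ConservativeOn lam T₂ c₂) (hfd : IsFundDomOn lam T₂ d₂ D₂)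
    (h : ∀ ε : ℝ≥0∞, 0 < ε → Cl lam T₁ T₂ ε) : lam D₁ ≤ lam D₂ := by
  apply ENNReal.le_of_forall_pos_le_add
  intro ε hε _
  obtain ⟨S, hS, hE⟩ := h ε (by exact_mod_cast hε)
  set E := {y | S (T₁ y) ≠ T₂ (S y)} with hEdef
  have hEm : MeasurableSet E := by
    have : E = (fun y => (S (T₁ y), T₂ (S y))) ⁻¹' (diagonal X)ᶜ := by
      ext; simp [E]
    rw [this]
    exact ((S.measurable.comp T₁.measurable).prodMk (T₂.measurable.comp S.measurable))
      (measurableSet_diagonal.compl)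
  have hw := fd_wand hfd₁
  let D' := D₁ \ ⋃ n : ℤ, zp T₁ n ⁻¹' E
  have hD'm : MeasurableSet D' := hD₁.diff (.iUnion fun n => zp_measurable _ _ hEm)
  have h1 : lam D₁ ≤ lam D' + ε := by
    calc lam D₁ ≤ lam (D' ∪ ⋃ n : ℤ, D₁ ∩ zp T₁ n ⁻¹' E) := by
          apply measure_mono
          intro x hx
          by_cases h : x ∈ ⋃ n : ℤ, zp T₁ n ⁻¹' E
          · obtain ⟨n, hn⟩ := mem_iUnion.1 h
            exact Or.inr (mem_iUnion.2 ⟨n, hx, hn⟩)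
          · exact Or.inl ⟨hx, h⟩
      _ ≤ _ := measure_union_le _ _
      _ ≤ lam D' + ε := by
        gcongr
        exact (measure_iUnion_le _).trans ((hw.sum_le hT₁ hD₁ hEm).trans hE)
  have hkey : ∀ x, x ∈ D' → ∀ n : ℤ, S (zp T₁ n x) = zp T₂ n (S x) := by
    intro x hx
    have hno : ∀ n : ℤ, S (T₁ (zp T₁ n x)) = T₂ (S (zp T₁ n x)) := by
      intro n
      by_contra hn
      exact hx.2 (mem_iUnion.2 ⟨n, hn⟩)
    intro n
    induction n using Int.induction_on with
    | zero => rfl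
    | succ n ih => rw [zp_succ, zp_succ, hno, ih]
    | pred n ih =>
      apply T₂.injective
      rw [← hno, ← zp_succ, ← zp_succ]
      simpa using ih
  have hw2 : Wand T₂ (S.symm ⁻¹' D') := by
    intro y n m hn hm
    have e1 := hkey _ hn (m - n)
    rw [S.apply_symm_apply, ← zp_add, sub_add_cancel] at e1
    have e2 : zp T₁ (m - n) (S.symm (zp T₂ n y)) ∈ D₁ := by
      have e3 := hm.1
      rwa [← e1, S.symm_apply_apply] at e3
    have := hw _ 0 _ hn.1 e2
    omega
  have := wand_le hT₂ hc hD hcover hcons hfd hw2 (S.symm.measurable hD'm)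
  rw [(hS.symm S).measure_preimage_equiv] at this
  exact h1.trans (by gcongr)
end P5
end AC

namespace AC
open Filter Topology

section P6
variable [MeasurableSpace X] {lam : Measure X}

lemma zp_free {T : X ≃ᵐ X} {x : X} (h : ∀ n : ℕ, 1 ≤ n → (⇑T)^[n] x ≠ x) {n m : ℤ}
    (e : zp T n x = zp T m x) : n = m := by
  have key : ∀ k : ℤ, 1 ≤ k → zp T k x ≠ x := by
    intro k hk
    obtain ⟨a, rfl⟩ := Int.eq_ofNat_of_zero_le (by omega : 0 ≤ k)
    rw [zp_nat]
    exact h a (by omega)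
  rcases lt_trichotomy n m with h1 | h1 | h1
  · exfalso; apply key (m - n) (by omega)
    apply zp_inj T n
    rw [← zp_add, add_sub_cancel, e]
  · exact h1
  · exfalso; apply key (n - m) (by omega)
    apply zp_inj T m
    rw [← zp_add, add_sub_cancel, e]

lemma zp_free' {T : X ≃ᵐ X} {x : X} (h : ∀ n : ℕ, 1 ≤ n → (⇑T)^[n] x ≠ x) (k : ℤ) :
    ∀ n : ℕ, 1 ≤ n → (⇑T)^[n] (zp T k x) ≠ zp T k x := by
  intro n hn e
  rw [← zp_nat, ← zp_add] at e
  have := zp_free h e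
  omega

lemma meas_free [StandardBorelSpace X] (T : X ≃ᵐ X) :
    MeasurableSet {x | ∀ n : ℕ, 1 ≤ n → (⇑T)^[n] x ≠ x} := by
  have : {x | ∀ n : ℕ, 1 ≤ n → (⇑T)^[n] x ≠ x} =
      ⋂ n : ℕ, ⋂ _ : 1 ≤ n, (fun x => ((⇑T)^[n] x, x)) ⁻¹' (diagonal X)ᶜ := by
    ext x; simp
  rw [this]
  exact .iInter fun n => .iInter fun _ =>
    ((T.measurable.iterate n).prodMk measurable_id) measurableSet_diagonal.compl

lemma section_piece [StandardBorelSpace X] {T : X ≃ᵐ X}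
    {c A : Set X} (hcons : ConservativeOn lam T c) (hap : Aperiodic lam T) (hA : MeasurableSet A)
    (hAc : A ⊆ c) (hfin : lam A ≠ ∞) {δ : ℝ≥0∞} (hδ : 0 < δ) :
    ∃ B ⊆ A, MeasurableSet B ∧ lam B < δ ∧ ∀ᵐ x ∂lam, x ∈ A → ∃ n : ℤ, zp T n x ∈ B := by
  classical
  let P := {x | ∀ n : ℕ, 1 ≤ n → (⇑T)^[n] x ≠ x}
  have hP : MeasurableSet P := meas_free T
  let f : X → ℝ≥0∞ := fun x => ENNReal.ofReal (Real.exp (embeddingReal X x))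
  have hf : Measurable f :=
    ENNReal.measurable_ofReal.comp (Real.measurable_exp.comp (measurable_embeddingReal X))
  have hfi : Function.Injective f := by
    intro x y hxy
    have h1 := (ENNReal.ofReal_eq_ofReal_iff (Real.exp_pos _).le (Real.exp_pos _).le).1 hxy
    exact (measurableEmbedding_embeddingReal X).injective (Real.exp_injective h1)
  have hft : ∀ x, f x ≠ ∞ := fun x => ENNReal.ofReal_ne_top
  let F : X → ℝ≥0∞ := fun x => if x ∈ A then f x else ∞
  have hF : Measurable F := Measurable.ite hA hf measurable_const
  let g : X → ℝ≥0∞ := fun x => ⨅ n : ℤ, F (zp T n x)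
  have hg : Measurable g := .iInf fun n => hF.comp (zp_measurable T n)
  have hginv : ∀ x n, g (zp T n x) = g x := by
    intro x n
    apply le_antisymm
    · refine le_iInf fun m => (iInf_le _ (m - n)).trans ?_
      rw [← zp_add, sub_add_cancel]
    · refine le_iInf fun m => (iInf_le _ (m + n)).trans ?_
      rw [← zp_add]
  have hgf : ∀ x ∈ A, g x ≤ f x := fun x hx => (iInf_le _ 0).trans (by
    change (if x ∈ A then f x else ∞) ≤ _
    rw [if_pos hx])
  let B : ℕ → Set X := fun k => {x | x ∈ A ∩ P ∧ f x < g x + (k + 1 : ℝ≥0∞)⁻¹}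
  have hBm : ∀ k, MeasurableSet (B k) := fun k =>
    (hA.inter hP).inter (measurableSet_lt hf (hg.add_const _))
  have hanti : Antitone B := by
    intro k l hkl x hx
    refine ⟨hx.1, hx.2.trans_le ?_⟩
    gcongr
  have hinter : lam (⋂ k, B k) = 0 := by
    refine wand_null hcons ?_ (.iInter hBm) (fun x hx => hAc ((mem_iInter.1 hx 0).1.1))
    have hval : ∀ y, y ∈ (⋂ k, B k) → f y = g y := by
      intro y hy
      apply le_antisymm _ (hgf y (mem_iInter.1 hy 0).1.1)
      apply ENNReal.le_of_forall_pos_le_add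
      intro ε hε _
      obtain ⟨k, hk⟩ := ENNReal.exists_inv_nat_lt (a := (ε : ℝ≥0∞)) (by simpa using hε.ne')
      refine (mem_iInter.1 hy k).2.le.trans ?_
      gcongr
      refine le_trans ?_ hk.le
      gcongr
      exact le_self_add
    intro x n m hn hm
    have e1 : zp T n x = zp T m x := by
      apply hfi
      rw [hval _ hn, hval _ hm, hginv, hginv]
    have hfree : ∀ n : ℕ, 1 ≤ n → (⇑T)^[n] (zp T n x) ≠ zp T n x := by
      intro k hk
      have := zp_free' (mem_iInter.1 hn 0).1.2 (k - n) k hk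
      rwa [← zp_add, sub_add_cancel] at this
    have hx : zp T (-n) (zp T n x) = x := zp_neg_zp T n x
    have h2 := zp_free' (mem_iInter.1 hn 0).1.2 (-n)
    rw [hx] at h2
    exact zp_free h2 e1
  have hlim : Tendsto (lam ∘ B) atTop (𝓝 (lam (⋂ k, B k))) :=
    tendsto_measure_iInter_atTop (fun k => (hBm k).nullMeasurableSet) hanti
      ⟨0, ne_top_of_le_ne_top hfin (measure_mono fun x hx => hx.1.1)⟩
  rw [hinter] at hlim
  obtain ⟨k, hk⟩ := (hlim.eventually_lt_const hδ).exists
  refine ⟨B k, fun x hx => hx.1.1, hBm k, hk, ?_⟩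
  filter_upwards [hap] with x hx hxA
  have hgt : g x ≠ ∞ := ne_top_of_le_ne_top (hft x) (hgf x hxA)
  have hlt : g x < g x + (k + 1 : ℝ≥0∞)⁻¹ :=
    ENNReal.lt_add_right hgt (ENNReal.inv_ne_zero.2 (by finiteness))
  obtain ⟨n, hn⟩ := iInf_lt_iff.1 (show (⨅ n : ℤ, F (zp T n x)) < _ from hlt)
  have hnA : zp T n x ∈ A := by
    by_contra h
    simp only [F, if_neg h] at hn
    exact absurd hn not_top_lt
  refine ⟨n, ⟨hnA, zp_free' hx n⟩, ?_⟩
  rw [hginv]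
  simpa only [F, if_pos hnA] using hn

lemma section_exists [StandardBorelSpace X] [SigmaFinite lam] {T : X ≃ᵐ X}
    (hT : MeasurePreserving T lam lam)
    {c : Set X} (hc : MeasurableSet c) (hcons : ConservativeOn lam T c) (hap : Aperiodic lam T)
    {δ : ℝ≥0∞} (hδ : 0 < δ) :
    ∃ B ⊆ c, MeasurableSet B ∧ lam B < δ ∧ ∀ᵐ x ∂lam, x ∈ c → ∀ N : ℤ,
      (∃ m ≥ N, zp T m x ∈ B) ∧ (∃ m ≤ N, zp T m x ∈ B) := by
  obtain ⟨δ', hδ', hsum⟩ := ENNReal.exists_pos_sum_of_countable hδ.ne' ℕ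
  have h1 : ∀ i : ℕ, ∃ B ⊆ c ∩ spanningSets lam i, MeasurableSet B ∧ lam B < δ' i ∧
      ∀ᵐ x ∂lam, x ∈ c ∩ spanningSets lam i → ∃ n : ℤ, zp T n x ∈ B := fun i =>
    section_piece hcons hap (hc.inter (measurableSet_spanningSets lam i)) inter_subset_left
      (ne_top_of_le_ne_top (measure_spanningSets_lt_top lam i).ne (measure_mono inter_subset_right))
      (by exact_mod_cast hδ' i)
  choose B hBc hBm hBδ hB using h1
  have hBc' : (⋃ i, B i) ⊆ c := iUnion_subset fun i => (hBc i).trans inter_subset_left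
  have hUm : MeasurableSet (⋃ i, B i) := .iUnion hBm
  refine ⟨⋃ i, B i, hBc', hUm, ?_, ?_⟩
  · exact (measure_iUnion_le _).trans_lt ((ENNReal.tsum_le_tsum fun i => (hBδ i).le).trans_lt hsum)
  · set U := ⋃ i, B i
    have hv1 : lam {x | x ∈ U ∧ ∀ n : ℕ, zp T (n + 1) x ∉ U} = 0 := by
      refine wand_null hcons ?_ ?_ (fun x hx => hBc' hx.1)
      · have key : ∀ x (n m : ℤ), n < m → zp T n x ∈ {x | x ∈ U ∧ ∀ n : ℕ, zp T (n + 1) x ∉ U} →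
            zp T m x ∈ {x | x ∈ U ∧ ∀ n : ℕ, zp T (n + 1) x ∉ U} → False := by
          intro x n m hnm hn hm
          obtain ⟨k, hk⟩ := Int.eq_ofNat_of_zero_le (by omega : 0 ≤ m - n - 1)
          apply hn.2 k
          rw [← zp_add]
          convert hm.1 using 2
          omega
        intro x n m hn hm
        rcases lt_trichotomy n m with h | h | h
        · exact (key x n m h hn hm).elim
        · exact h
        · exact (key x m n h hm hn).elim
      · have : {x | x ∈ U ∧ ∀ n : ℕ, zp T (n + 1) x ∉ U} =
            U ∩ ⋂ n : ℕ, (zp T (n + 1) ⁻¹' U)ᶜ := by ext x; simp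
        rw [this]
        exact hUm.inter (.iInter fun n => (zp_measurable T _ hUm).compl)
    have hv2 : lam {x | x ∈ U ∧ ∀ n : ℕ, zp T (-(n + 1)) x ∉ U} = 0 := by
      refine wand_null hcons ?_ ?_ (fun x hx => hBc' hx.1)
      · have key : ∀ x (n m : ℤ), n < m →
            zp T n x ∈ {x | x ∈ U ∧ ∀ n : ℕ, zp T (-(n + 1)) x ∉ U} →
            zp T m x ∈ {x | x ∈ U ∧ ∀ n : ℕ, zp T (-(n + 1)) x ∉ U} → False := by
          intro x n m hnm hn hm
          obtain ⟨k, hk⟩ := Int.eq_ofNat_of_zero_le (by omega : 0 ≤ m - n - 1)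
          apply hm.2 k
          rw [← zp_add]
          convert hn.1 using 2
          omega
        intro x n m hn hm
        rcases lt_trichotomy n m with h | h | h
        · exact (key x n m h hn hm).elim
        · exact h
        · exact (key x m n h hm hn).elim
      · have : {x | x ∈ U ∧ ∀ n : ℕ, zp T (-(n + 1)) x ∉ U} =
            U ∩ ⋂ n : ℕ, (zp T (-(n + 1)) ⁻¹' U)ᶜ := by ext x; simp
        rw [this]
        exact hUm.inter (.iInter fun n => (zp_measurable T _ hUm).compl)
    rw [measure_eq_zero_iff_ae_notMem] at hv1 hv2
    filter_upwards [ae_zp T hT hv1, ae_zp T hT hv2, ae_all_iff.2 hB] with x h1 h2 h3 hxc N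
    have hex : ∃ m : ℤ, zp T m x ∈ U := by
      have : x ∈ ⋃ i, spanningSets lam i := by rw [iUnion_spanningSets]; trivial
      obtain ⟨i, hi⟩ := mem_iUnion.1 this
      obtain ⟨n, hn⟩ := h3 i ⟨hxc, hi⟩
      exact ⟨n, mem_iUnion.2 ⟨i, hn⟩⟩
    obtain ⟨m₀, hm₀⟩ := hex
    have up : ∀ k : ℕ, ∃ m ≥ m₀ + k, zp T m x ∈ U := by
      intro k
      induction k with
      | zero => exact ⟨m₀, by simp, hm₀⟩
      | succ k ih =>
        obtain ⟨m, hm, hmU⟩ := ih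
        by_contra hcon
        push Not at hcon
        apply h1 m
        refine ⟨hmU, fun n => ?_⟩
        rw [← zp_add]
        apply hcon
        push_cast; omega
    have dn : ∀ k : ℕ, ∃ m ≤ m₀ - k, zp T m x ∈ U := by
      intro k
      induction k with
      | zero => exact ⟨m₀, by simp, hm₀⟩
      | succ k ih =>
        obtain ⟨m, hm, hmU⟩ := ih
        by_contra hcon
        push Not at hcon
        apply h2 m
        refine ⟨hmU, fun n => ?_⟩
        rw [← zp_add]
        apply hcon
        push_cast; omega
    constructor
    · obtain ⟨m, hm, hmU⟩ := up (N - m₀).toNat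
      exact ⟨m, by omega, hmU⟩
    · obtain ⟨m, hm, hmU⟩ := dn (m₀ - N).toNat
      exact ⟨m, by omega, hmU⟩
end P6
end AC

namespace AC
open Filter Topology

section P7
variable [MeasurableSpace X] [StandardBorelSpace X] {lam : Measure X} [SigmaFinite lam]
  [NullSingletonClass lam]

lemma vol_lt (t : ℝ≥0∞) : volume {s : ℝ | 0 ≤ s ∧ ENNReal.ofReal s < t} = t := by
  by_cases ht : t = ∞
  · subst ht
    have : {s : ℝ | 0 ≤ s ∧ ENNReal.ofReal s < ∞} = Ici 0 := by ext; simp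
    rw [this, Real.volume_Ici]
  · have : {s : ℝ | 0 ≤ s ∧ ENNReal.ofReal s < t} = Ico 0 t.toReal := by
      ext s
      simp only [mem_ofPred_eq, mem_Ico]
      refine and_congr_right fun hs => ?_
      rw [ENNReal.ofReal_lt_iff_lt_toReal hs ht]
    rw [this, Real.volume_Ico, sub_zero, ENNReal.ofReal_toReal ht]

lemma exists_subset {A : Set X} (hA : MeasurableSet A) {t : ℝ≥0∞} (ht : t ≤ lam A) :
    ∃ B ⊆ A, MeasurableSet B ∧ lam B = t := by
  rcases A.eq_empty_or_nonempty with h | ⟨a, ha⟩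
  · subst h
    exact ⟨∅, subset_rfl, .empty, by simp at ht ⊢; exact ht.symm⟩
  have : Nonempty X := ⟨a⟩
  obtain ⟨f, g, hg, hf, -⟩ := param (lam.restrict A)
  have hm : MeasurableSet {s : ℝ | ENNReal.ofReal s < t} :=
    measurableSet_lt ENNReal.measurable_ofReal measurable_const
  refine ⟨f ⁻¹' {s : ℝ | ENNReal.ofReal s < t} ∩ A, inter_subset_right,
    (hf.measurable hm).inter hA, ?_⟩
  have h1 := hf.measure_preimage hm.nullMeasurableSet
  rw [Measure.restrict_apply (hf.measurable hm), Measure.restrict_apply hm] at h1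
  rw [h1]
  have : {s : ℝ | ENNReal.ofReal s < t} ∩ {s : ℝ | 0 ≤ s ∧ ENNReal.ofReal s < lam.restrict A univ}
      = {s : ℝ | 0 ≤ s ∧ ENNReal.ofReal s < t} := by
    ext s
    simp only [Measure.restrict_apply_univ, mem_inter_iff, mem_ofPred_eq]
    constructor
    · rintro ⟨a, b, c⟩; exact ⟨b, a⟩
    · rintro ⟨a, b⟩; exact ⟨b, a, b.trans_le ht⟩
  rw [this, vol_lt]

lemma swap (hX : lam univ ≠ 0) {B B' : Set X} (hB : MeasurableSet B) (hB' : MeasurableSet B')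
    (hdisj : Disjoint B B') (he : lam B = lam B') :
    ∃ σ : X ≃ᵐ X, MeasurePreserving σ lam lam ∧ (∀ᵐ x ∂lam, x ∈ B → σ x ∈ B') ∧
      (∀ᵐ x ∂lam, x ∈ B' → σ x ∈ B) ∧ ∀ᵐ x ∂lam, x ∉ B → x ∉ B' → σ x = x := by
  have hne : NeZero lam := ⟨fun h => hX (by simp [h])⟩
  have hXne : Nonempty X := by
    by_contra h
    rw [not_nonempty_iff] at h
    exact hX (by simp [Set.eq_empty_of_isEmpty])
  obtain ⟨f, g, hg, hf, hgf⟩ := iso (lam.restrict B) (lam.restrict B') (by simpa using he)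
  obtain ⟨f', g', hg', hf', hgf'⟩ := iso (lam.restrict B') (lam.restrict B) (by simpa using he.symm)
  obtain ⟨S, hS, h⟩ := glue lam hX (ι := Fin 3) ![B, B', (B ∪ B')ᶜ] ![B', B, (B ∪ B')ᶜ]
    (by
      intro i; fin_cases i
      exacts [hB, hB', (hB.union hB').compl])
    (by
      intro i; fin_cases i
      exacts [hB', hB, (hB.union hB').compl])
    (by
      have h1 := Set.disjoint_left.1 hdisj
      intro i j hij
      apply Set.disjoint_left.2
      intro x
      fin_cases i <;> fin_cases j <;> simp at hij ⊢ <;> tauto)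
    (by
      have h1 := Set.disjoint_left.1 hdisj
      intro i j hij
      apply Set.disjoint_left.2
      intro x
      fin_cases i <;> fin_cases j <;> simp at hij ⊢ <;> tauto)
    (by
      refine .of_forall fun x => ?_
      by_cases h1 : x ∈ B
      · exact ⟨0, h1⟩
      by_cases h2 : x ∈ B'
      · exact ⟨1, h2⟩
      exact ⟨2, by simp [h1, h2]⟩)
    (by
      refine .of_forall fun x => ?_
      by_cases h1 : x ∈ B
      · exact ⟨1, h1⟩
      by_cases h2 : x ∈ B'
      · exact ⟨0, h2⟩
      exact ⟨2, by simp [h1, h2]⟩)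
    ![f, f', id] ![g, g', id]
    (by
      intro i; fin_cases i
      exacts [hg, hg', measurable_id])
    (by
      intro i; fin_cases i
      exacts [hf.measurable, hf'.measurable, measurable_id])
    (by
      intro i; fin_cases i
      exacts [hf, hf', MeasurePreserving.id _])
    (by
      intro i; fin_cases i
      exacts [hgf, hgf', .of_forall fun x => rfl])
  have m1 : ∀ᵐ x ∂lam, x ∈ B → f x ∈ B' :=
    (ae_restrict_iff' hB).1 (hf.quasiMeasurePreserving.ae (ae_restrict_mem hB'))
  have m2 : ∀ᵐ x ∂lam, x ∈ B' → f' x ∈ B :=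
    (ae_restrict_iff' hB').1 (hf'.quasiMeasurePreserving.ae (ae_restrict_mem hB))
  refine ⟨S, hS, ?_, ?_, ?_⟩
  · filter_upwards [h, m1] with x h1 h2 hx
    have := h1 0 hx
    rw [this]; exact h2 hx
  · filter_upwards [h, m2] with x h1 h2 hx
    have := h1 1 hx
    rw [this]; exact h2 hx
  · filter_upwards [h] with x h1 hx hx'
    exact h1 2 (by simp [hx, hx'])

lemma caseA_one (hX : lam univ ≠ 0) {T : X ≃ᵐ X} (hT : MeasurePreserving T lam lam)
    (hap : Aperiodic lam T) {c d D : Set X}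
    (hc : MeasurableSet c) (hD : MeasurableSet D)
    (hdisj : Disjoint c d) (hcover : c ∪ d = univ) (hinv : ⇑T '' c = c)
    (hcons : ConservativeOn lam T c) (hfd : IsFundDomOn lam T d D) (h0 : 0 < lam D)
    {ε : ℝ≥0∞} (hε : 0 < ε) :
    ∃ (T' : X ≃ᵐ X) (D' : Set X), MeasurePreserving T' lam lam ∧ MeasurableSet D' ∧
      lam D' = lam D ∧ Wand T' D' ∧ (∀ᵐ x ∂lam, ∃ n : ℤ, zp T' n x ∈ D') ∧
      lam {x | T x ≠ T' x} ≤ ε := by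
  obtain ⟨B, hBc, hB, hBδ, hrec⟩ := section_exists hT hc hcons hap
    (δ := min (ε / 2) (lam D)) (lt_min (ENNReal.half_pos hε.ne') h0)
  obtain ⟨B', hB'D, hB', hBB'⟩ := exists_subset hD (hBδ.le.trans (min_le_right _ _))
  have hcD : ∀ x, x ∈ c → x ∉ D := fun x h h' => Set.disjoint_left.1 hdisj h (hfd.1 h')
  have hBB : Disjoint B B' := Set.disjoint_left.2 fun x h h' => hcD x (hBc h) (hB'D h')
  obtain ⟨σ, hσ, s1, s2, s3⟩ := swap hX hB hB' hBB hBB'.symm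
  have hcT : ∀ x, T x ∈ c ↔ x ∈ c := by
    intro x
    constructor
    · intro h
      rw [← hinv] at h
      obtain ⟨y, hy, e⟩ := h
      rwa [← T.injective e]
    · intro h; rw [← hinv]; exact ⟨x, h, rfl⟩
  have hcz : ∀ (n : ℤ) x, zp T n x ∈ c ↔ x ∈ c := by
    intro n x
    induction n using Int.induction_on with
    | zero => rfl
    | succ n ih => rw [zp_succ, hcT, ih]
    | pred n ih => rw [← ih, ← hcT, ← zp_succ]; congr! 2; ring
  have hw := fd_wand hfd
  set T' : X ≃ᵐ X := T.trans σ with hT'def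
  have hT'a : ∀ x, T' x = σ (T x) := fun x => rfl
  have hT' : MeasurePreserving T' lam lam := hσ.comp hT
  -- a.e. facts
  have a0 : ∀ᵐ x ∂lam, T x ∉ B → T x ∉ B' → T' x = T x := hT.quasiMeasurePreserving.ae s3
  have s4 : ∀ᵐ y ∂lam, y ∈ B → σ.symm y ∈ B' := by
    have : ∀ᵐ z ∂lam, σ z ∈ B → z ∈ B' := by
      filter_upwards [s1, s3] with z h1 h3 hz
      by_contra hn
      by_cases hzB : z ∈ B
      · exact Set.disjoint_left.1 hBB hz (h1 hzB)
      · rw [h3 hzB hn] at hz; exact hzB hz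
    filter_upwards [(hσ.symm σ).quasiMeasurePreserving.ae this] with y hy hyB
    exact hy (by rwa [σ.apply_symm_apply])
  have s5 : ∀ᵐ y ∂lam, y ∈ B' → σ.symm y ∈ B := by
    have : ∀ᵐ z ∂lam, σ z ∈ B' → z ∈ B := by
      filter_upwards [s2, s3] with z h1 h3 hz
      by_contra hn
      by_cases hzB : z ∈ B'
      · exact Set.disjoint_left.1 hBB (h1 hzB) hz
      · rw [h3 hn hzB] at hz; exact hzB hz
    filter_upwards [(hσ.symm σ).quasiMeasurePreserving.ae this] with y hy hyB
    exact hy (by rwa [σ.apply_symm_apply])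
  have hT's : ∀ y, T'.symm y = T.symm (σ.symm y) := fun y => rfl
  -- invariant set
  let W : Set X := {x | ∃ n : ℤ, T (zp T' n x) ∈ D}
  have hWi : ∀ x, T' x ∈ W ↔ x ∈ W := by
    intro x
    constructor
    · rintro ⟨n, hn⟩; exact ⟨n + 1, by rwa [zp_succ']⟩
    · rintro ⟨n, hn⟩; exact ⟨n - 1, by rwa [← zp_succ', sub_add_cancel]⟩
  have hWs : ∀ x, T'.symm x ∈ W ↔ x ∈ W := by
    intro x; rw [← hWi, T'.apply_symm_apply]
  have c1 : ∀ᵐ y ∂lam, y ∈ B → y ∈ W := by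
    filter_upwards [s4] with y hy hyB
    rw [← hWs]
    refine ⟨0, ?_⟩
    rw [zp_zero, hT's, T.apply_symm_apply]
    exact hB'D (hy hyB)
  have c2 : ∀ᵐ x ∂lam, x ∈ c → x ∈ W := by
    filter_upwards [ae_zp T hT c1, ae_zp T hT a0, hrec] with x h1 h2 h3 hxc
    obtain ⟨m, hm, hmB⟩ := (h3 hxc 0).2
    have key : ∀ k : ℕ, zp T (m + k) x ∈ W := by
      intro k
      induction k with
      | zero => simpa using h1 m hmB
      | succ k ih =>
        by_cases hk : zp T (m + (k + 1 : ℕ)) x ∈ B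
        · exact h1 _ hk
        · have e : zp T (m + (k + 1 : ℕ)) x = T (zp T (m + k) x) := by
            rw [← zp_succ]; congr 1; push_cast; ring
          rw [e, ← h2 (m + k) (by rwa [← e]) ?_, hWi]
          · exact ih
          · rw [← e]
            intro h
            exact hcD _ ((hcz _ _).2 hxc) (hB'D h)
    have := key (-m).toNat
    have e : m + ((-m).toNat : ℤ) = 0 := by omega
    rwa [e, zp_zero] at this
  have c3 : ∀ᵐ x ∂lam, x ∈ D → x ∈ W := by
    have a0' := (hT.symm T).quasiMeasurePreserving.ae a0
    filter_upwards [ae_zp T' hT' c2, s5, a0'] with x h1 h2 h3 hxD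
    by_cases hx : x ∈ B'
    · rw [← hWs, ← zp_neg_one]
      apply h1
      rw [zp_neg_one, hT's, ← hcT, T.apply_symm_apply]
      exact hBc (h2 hx)
    · rw [T.apply_symm_apply] at h3
      rw [← h3 (fun h => hcD x (hBc h) hxD) hx, hWi]
      exact ⟨0, by rwa [zp_zero, T.apply_symm_apply]⟩
  have c4 : ∀ᵐ x ∂lam, x ∈ W := by
    filter_upwards [c2, ae_zp T hT c3, ae_zp T hT a0, fd_cover hfd] with x h2 h3 h4 h5
    by_cases hxc : x ∈ c
    · exact h2 hxc
    have hxd : x ∈ d := by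
      have : x ∈ c ∪ d := hcover ▸ mem_univ x
      exact this.resolve_left hxc
    obtain ⟨n, hn⟩ := h5 hxd
    have hnot : ∀ m, m ≠ n → zp T m x ∉ B ∧ zp T m x ∉ B' := by
      intro m hm
      refine ⟨fun h => hxc ((hcz _ _).1 (hBc h)), fun h => hm (hw x _ _ (hB'D h) hn)⟩
    have key : ∀ i : ℤ, zp T (n + i) x ∈ W := by
      intro i
      induction i using Int.induction_on with
      | zero => simpa using h3 n hn
      | succ i ih =>
        obtain ⟨p, q⟩ := hnot (n + (i + 1)) (by omega)
        have e : zp T (n + (i + 1)) x = T (zp T (n + i) x) := by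
          rw [← zp_succ]; congr 1; ring
        rw [e] at p q ⊢
        rw [← h4 _ p q, hWi]
        exact ih
      | pred i ih =>
        have e : zp T (n + -(i : ℤ)) x = T (zp T (n + (-i - 1)) x) := by
          rw [← zp_succ]; congr 1; ring
        by_cases hi : i = 0
        · subst hi
          refine ⟨0, ?_⟩
          rw [zp_zero, ← e]
          simpa using hn
        · obtain ⟨p, q⟩ := hnot (n + -(i : ℤ)) (by omega)
          rw [e] at p q ih
          rw [← h4 _ p q, hWi] at ih
          exact ih
    have := key (-n)
    rwa [add_neg_cancel, zp_zero] at this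
  -- wandering
  let N : Set X := {x | x ∈ c ∨ ∃ k : ℕ, zp T (-k) x ∈ D}
  let Q : X → Prop := fun x => (x ∈ N ∨ T x ∈ D) → T' x ∈ N
  have hDN : ∀ x, T x ∈ D → x ∉ N := by
    rintro x hx (h | ⟨k, hk⟩)
    · exact hcD _ ((hcT x).2 h) hx
    · have := hw x 1 (-k) (by rwa [zp_one]) hk
      omega
  have hQ : ∀ᵐ x ∂lam, Q x := by
    filter_upwards [a0, hT.quasiMeasurePreserving.ae s1, hT.quasiMeasurePreserving.ae s2]
      with x h0 h1 h2 hx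
    by_cases hb : T x ∈ B
    · exact Or.inr ⟨0, hB'D (h1 hb)⟩
    by_cases hb' : T x ∈ B'
    · exact Or.inl (hBc (h2 hb'))
    rw [h0 hb hb']
    rcases hx with (h | ⟨k, hk⟩) | h
    · exact Or.inl ((hcT x).2 h)
    · refine Or.inr ⟨k + 1, ?_⟩
      rw [← zp_succ']
      convert hk using 2
      push_cast; ring
    · exact Or.inr ⟨0, h⟩
  have hQz := ae_zp T' hT' hQ
  obtain ⟨G, hGsub, hGm, hG0⟩ := exists_measurable_superset_of_null (ae_iff.1 hQz)
  have hGQ : ∀ x, x ∉ G → ∀ n : ℤ, Q (zp T' n x) := by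
    intro x hx
    by_contra h
    exact hx (hGsub h)
  have hDm : MeasurableSet (T ⁻¹' D \ G) := (T.measurable hD).diff hGm
  refine ⟨T', T ⁻¹' D \ G, hT', hDm, ?_, ?_, ?_, ?_⟩
  · rw [measure_sdiff_null hG0, hT.measure_preimage_equiv]
  · have key : ∀ x (n m : ℤ), n < m → zp T' n x ∈ T ⁻¹' D \ G → zp T' m x ∈ T ⁻¹' D \ G → False := by
      intro x n m hnm hn hm
      have hN : ∀ k : ℕ, zp T' (k + 1) (zp T' n x) ∈ N := by
        intro k
        induction k with
        | zero =>
          have := hGQ _ hn.2 0 (Or.inr hn.1)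
          simpa [zp_one, zp_zero] using this
        | succ k ih =>
          have := hGQ _ hn.2 (k + 1) (Or.inl ih)
          rw [← zp_succ] at this
          exact_mod_cast this
      apply hDN _ hm.1
      have := hN (m - n - 1).toNat
      rw [← zp_add] at this
      convert this using 2
      omega
    intro x n m hn hm
    rcases lt_trichotomy n m with h | h | h
    · exact (key x n m h hn hm).elim
    · exact h
    · exact (key x m n h hm hn).elim
  · have hGz := ae_zp T' hT' (measure_eq_zero_iff_ae_notMem.1 hG0)
    filter_upwards [c4, hGz] with x ⟨n, hn⟩ hx
    exact ⟨n, hn, hx n⟩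
  · have : lam {x | T x ≠ T' x} ≤ lam (T ⁻¹' B ∪ T ⁻¹' B') := by
      apply measure_mono_ae
      filter_upwards [a0] with x hx hne
      by_contra hcon
      apply hne
      have hcon : ¬ (T x ∈ B ∨ T x ∈ B') := hcon
      rw [not_or] at hcon
      exact (hx hcon.1 hcon.2).symm
    refine this.trans ((measure_union_le _ _).trans ?_)
    rw [hT.measure_preimage_equiv, hT.measure_preimage_equiv, hBB']
    have h2 : lam B ≤ ε / 2 := hBδ.le.trans (min_le_left _ _)
    calc _ ≤ ε / 2 + ε / 2 := add_le_add h2 h2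
      _ = ε := ENNReal.add_halves ε

lemma caseA_conj (hX : lam univ ≠ 0) {T₁ T₂ : X ≃ᵐ X} (hT₁ : MeasurePreserving T₁ lam lam)
    (hT₂ : MeasurePreserving T₂ lam lam) {D₁ D₂ : Set X} (hD₁ : MeasurableSet D₁)
    (hD₂ : MeasurableSet D₂) (he : lam D₁ = lam D₂) (hw₁ : Wand T₁ D₁) (hw₂ : Wand T₂ D₂)
    (hc₁ : ∀ᵐ x ∂lam, ∃ n : ℤ, zp T₁ n x ∈ D₁) (hc₂ : ∀ᵐ x ∂lam, ∃ n : ℤ, zp T₂ n x ∈ D₂) :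
    Cl lam T₁ T₂ 0 := by
  obtain ⟨S, hS, h⟩ := tower lam hX T₁ T₂ hT₁ hT₂ (K := Unit) (fun _ => univ) (fun _ => D₁)
    (fun _ => D₂) (fun _ => hD₁) (fun _ => hD₂) (fun _ => he)
    (fun k j k' j' _ _ x h1 h2 => by
      have := hw₁ _ _ _ h1 h2
      rw [neg_inj] at this; rw [this])
    (fun k j k' j' _ _ x h1 h2 => by
      have := hw₂ _ _ _ h1 h2
      rw [neg_inj] at this; rw [this])
    (by filter_upwards [hc₁] with x ⟨n, hn⟩; exact ⟨(), -n, trivial, by rwa [neg_neg]⟩)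
    (by filter_upwards [hc₂] with x ⟨n, hn⟩; exact ⟨(), -n, trivial, by rwa [neg_neg]⟩)
  refine ⟨S, hS, le_of_eq ?_⟩
  rw [← nonpos_iff_eq_zero, nonpos_iff_eq_zero]
  have : ∀ᵐ x ∂lam, S (T₁ x) = T₂ (S x) := by
    filter_upwards [h, hc₁] with x hx ⟨n, hn⟩
    exact hx () (-n) trivial trivial (by rwa [neg_neg])
  exact ae_iff.1 this

end P7
end AC

namespace AC
open Filter Topology

def Iv (a : ℕ → ℝ≥0∞) (n : ℕ) : Set ℝ :=
  {t | 0 ≤ t ∧ ENNReal.ofReal t < ∑ i ∈ Finset.range (n + 1), a i} \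
  {t | 0 ≤ t ∧ ENNReal.ofReal t < ∑ i ∈ Finset.range n, a i}

lemma meas_lt (s : ℝ≥0∞) : MeasurableSet {t : ℝ | 0 ≤ t ∧ ENNReal.ofReal t < s} :=
  (measurableSet_le measurable_const measurable_id).inter
    (measurableSet_lt ENNReal.measurable_ofReal measurable_const)

lemma Iv_meas (a : ℕ → ℝ≥0∞) (n : ℕ) : MeasurableSet (Iv a n) := (meas_lt _).diff (meas_lt _)

lemma Iv_vol (a : ℕ → ℝ≥0∞) (ha : ∀ n, a n ≠ ∞) (n : ℕ) : volume (Iv a n) = a n := by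
  have hs : ∑ i ∈ Finset.range n, a i ≠ ∞ := ENNReal.sum_ne_top.2 fun i _ => ha i
  unfold Iv
  rw [measure_sdiff _ (meas_lt _).nullMeasurableSet, vol_lt, vol_lt, Finset.sum_range_succ,
    ENNReal.add_sub_cancel_left hs]
  · rw [vol_lt]; exact hs
  · intro t ht
    refine ⟨ht.1, ht.2.trans_le ?_⟩
    rw [Finset.sum_range_succ]; exact le_self_add

lemma Iv_disj (a : ℕ → ℝ≥0∞) : Pairwise (Function.onFun Disjoint (Iv a)) := by
  have key : ∀ i j, i < j → Disjoint (Iv a i) (Iv a j) := by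
    intro i j hij
    apply Set.disjoint_left.2
    rintro t ⟨h1, -⟩ ⟨-, h2⟩
    apply h2
    refine ⟨h1.1, h1.2.trans_le (Finset.sum_le_sum_of_subset ?_)⟩
    intro k; simp; omega
  intro i j hij
  rcases lt_or_gt_of_ne hij with h | h
  · exact key i j h
  · exact (key j i h).symm

lemma Iv_union (a : ℕ → ℝ≥0∞) : ⋃ n, Iv a n = {t | 0 ≤ t ∧ ENNReal.ofReal t < ∑' n, a n} := by
  ext t
  constructor
  · intro h
    obtain ⟨n, hn⟩ := mem_iUnion.1 h
    exact ⟨hn.1.1, hn.1.2.trans_le (ENNReal.sum_le_tsum _)⟩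
  · rintro ⟨h0, h1⟩
    have hex : ∃ n, ENNReal.ofReal t < ∑ i ∈ Finset.range n, a i :=
      ((ENNReal.tendsto_nat_tsum a).eventually_const_lt h1).exists
    classical
    obtain ⟨n, hn⟩ : ∃ n, Nat.find hex = n := ⟨_, rfl⟩
    have h2 := Nat.find_spec hex
    rw [hn] at h2
    cases n with
    | zero => simp at h2
    | succ n =>
      refine mem_iUnion.2 ⟨n, ⟨h0, h2⟩, fun h3 => ?_⟩
      exact Nat.find_min hex (m := n) (by omega) h3.2

lemma matrix_exists (a b : ℕ → ℝ≥0∞) (ha : ∀ n, a n ≠ ∞) (hb : ∀ n, b n ≠ ∞)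
    (hab : ∑' n, a n = ∑' n, b n) : ∃ μ : ℕ → ℕ → ℝ≥0∞, (∀ n, ∑' m, μ n m = a n) ∧
      ∀ m, ∑' n, μ n m = b m := by
  have key : ∀ a b : ℕ → ℝ≥0∞, (∀ n, a n ≠ ∞) → (∑' n, a n = ∑' n, b n) →
      ∀ n, ∑' m, volume (Iv a n ∩ Iv b m) = a n := by
    intro a b ha hab n
    rw [← measure_iUnion, ← inter_iUnion, Iv_union, ← hab, ← Iv_union, inter_eq_left.2, Iv_vol a ha]
    · exact subset_iUnion _ n
    · intro i j hij
      exact (Iv_disj b hij).mono inter_subset_right inter_subset_right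
    · intro i; exact (Iv_meas a n).inter (Iv_meas b i)
  refine ⟨fun n m => volume (Iv a n ∩ Iv b m), key a b ha hab, fun m => ?_⟩
  simp_rw [inter_comm (Iv a _)]
  exact key b a hb hab.symm m

section P8
variable [MeasurableSpace X] [StandardBorelSpace X] {lam : Measure X} [SigmaFinite lam]
  [NullSingletonClass lam]

lemma partition_nat {A : Set X} (hA : MeasurableSet A) (w : ℕ → ℝ≥0∞) (hw : ∑' k, w k = lam A)
    (hfin : lam A ≠ ∞) :
    ∃ P : ℕ → Set X, (∀ k, MeasurableSet (P k)) ∧ (∀ k, P k ⊆ A) ∧ (∀ k, lam (P k) = w k) ∧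
      Pairwise (Function.onFun Disjoint P) ∧ ∀ᵐ x ∂lam, x ∈ A → ∃ k, x ∈ P k := by
  have hwf : ∀ k, w k ≠ ∞ := fun k => ne_top_of_le_ne_top hfin (hw ▸ ENNReal.le_tsum k)
  rcases A.eq_empty_or_nonempty with h | ⟨a, ha⟩
  · subst h
    simp only [measure_empty, ENNReal.tsum_eq_zero] at hw
    refine ⟨fun _ => ∅, fun _ => .empty, fun _ => subset_rfl, fun k => by simp [hw], ?_, by simp⟩
    intro i j _
    exact disjoint_bot_left
  have : Nonempty X := ⟨a⟩
  obtain ⟨f, g, hg, hf, -⟩ := param (lam.restrict A)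
  rw [Measure.restrict_apply_univ, ← hw, ← Iv_union] at hf
  refine ⟨fun k => f ⁻¹' Iv w k ∩ A, fun k => (hf.measurable (Iv_meas _ _)).inter hA,
    fun k => inter_subset_right, fun k => ?_, ?_, ?_⟩
  · have h1 := hf.measure_preimage (Iv_meas w k).nullMeasurableSet
    rw [Measure.restrict_apply (hf.measurable (Iv_meas _ _)), Measure.restrict_apply (Iv_meas _ _),
      inter_eq_left.2 (subset_iUnion _ k), Iv_vol w hwf] at h1
    exact h1
  · intro i j hij
    exact ((Iv_disj w hij).preimage f).mono inter_subset_left inter_subset_left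
  · have := hf.quasiMeasurePreserving.ae (ae_restrict_mem (.iUnion fun k => Iv_meas w k))
    rw [ae_restrict_iff' hA] at this
    filter_upwards [this] with x hx hxA
    obtain ⟨k, hk⟩ := mem_iUnion.1 (hx hxA)
    exact ⟨k, hk, hxA⟩

lemma partition_pair {A : Set X} (hA : MeasurableSet A) (w : ℕ → ℝ≥0∞)
    (hw : ∑' m : ℕ, m * w m = lam A) (hfin : lam A ≠ ∞) :
    ∃ C : ℕ → ℕ → Set X, (∀ m i, MeasurableSet (C m i)) ∧ (∀ m i, C m i ⊆ A) ∧
      (∀ m i, i < m → lam (C m i) = w m) ∧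
      (∀ m i m' i' x, x ∈ C m i → x ∈ C m' i' → m = m' ∧ i = i') ∧
      ∀ᵐ x ∂lam, x ∈ A → ∃ m i, i < m ∧ x ∈ C m i := by
  let v : ℕ → ℝ≥0∞ := fun k => if (Nat.unpair k).2 < (Nat.unpair k).1 then w (Nat.unpair k).1 else 0
  have hv : ∑' k, v k = lam A := by
    rw [← hw, ← Nat.pairEquiv.tsum_eq, ENNReal.tsum_prod']
    congr 1
    ext m
    have : ∀ i, v (Nat.pairEquiv (m, i)) = if i < m then w m else 0 := by
      intro i
      change v (Nat.pair m i) = _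
      simp [v]
    simp_rw [this]
    rw [tsum_eq_sum (s := Finset.range m)]
    · rw [Finset.sum_congr rfl (fun i hi => if_pos (Finset.mem_range.1 hi))]
      simp
    · intro i hi; exact if_neg (by simpa using hi)
  obtain ⟨P, h1, h2, h3, h4, h5⟩ := partition_nat hA v hv hfin
  refine ⟨fun m i => P (Nat.pair m i), fun m i => h1 _, fun m i => h2 _, ?_, ?_, ?_⟩
  · intro m i hi
    rw [h3]; simp [v, hi]
  · intro m i m' i' x hx hx'
    by_contra hne
    have : Nat.pair m i ≠ Nat.pair m' i' := by
      intro h; exact hne (Nat.pair_eq_pair.1 h)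
    exact Set.disjoint_left.1 (h4 this) hx hx'
  · have hz : ∀ᵐ x ∂lam, ∀ k, ¬ ((Nat.unpair k).2 < (Nat.unpair k).1) → x ∉ P k := by
      rw [ae_all_iff]; intro k
      by_cases hk : (Nat.unpair k).2 < (Nat.unpair k).1
      · exact .of_forall fun x h => absurd hk h
      · have : lam (P k) = 0 := by rw [h3]; simp [v, hk]
        filter_upwards [measure_eq_zero_iff_ae_notMem.1 this] with x hx _ using hx
    filter_upwards [h5, hz] with x hx hx' hxA
    obtain ⟨k, hk⟩ := hx hxA
    refine ⟨(Nat.unpair k).1, (Nat.unpair k).2, ?_, by rwa [Nat.pair_unpair]⟩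
    by_contra h
    exact hx' k h hk

lemma iso' [Nonempty X]
    (μ ν : Measure X) [SigmaFinite μ] [NullSingletonClass μ] [SigmaFinite ν] [NullSingletonClass ν]
    (h : μ univ = ν univ) :
    ∃ (f g : X → X), MeasurePreserving f μ ν ∧ MeasurePreserving g ν μ ∧
      (∀ᵐ x ∂μ, g (f x) = x) ∧ ∀ᵐ x ∂ν, f (g x) = x := by
  obtain ⟨f, g, hg, hf, h1⟩ := iso μ ν h
  refine ⟨f, g, hf, ⟨hg, ?_⟩, h1, ?_⟩
  · rw [← hf.map_eq, Measure.map_map hg hf.measurable]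
    rw [Measure.map_congr (f := g ∘ f) (g := id) h1, Measure.map_id]
  · rw [← hf.map_eq, ae_map_iff hf.aemeasurable]
    · filter_upwards [h1] with x hx; rw [hx]
    · exact measurableSet_eq_fun (hf.measurable.comp hg) measurable_id

structure Blk (lam : Measure X) (T : X ≃ᵐ X) (B : ℕ → Set X) (ε : ℝ≥0∞) : Prop where
  meas : ∀ n, MeasurableSet (B n)
  disj : ∀ (n j n' j' : ℕ), j < n → j' < n' → ∀ x, zp T (-j) x ∈ B n → zp T (-j') x ∈ B n' →
    n = n' ∧ j = j'
  cover : ∀ᵐ x ∂lam, ∃ n j : ℕ, j < n ∧ zp T (-j) x ∈ B n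
  small : ∑' n, lam (B n) ≤ ε

lemma blk_exists {T : X ≃ᵐ X} (hT : MeasurePreserving T lam lam) (hap : Aperiodic lam T)
    (hcons : ConservativeOn lam T univ) {ε : ℝ≥0∞} (hε : 0 < ε) : ∃ B, Blk lam T B ε := by
  obtain ⟨B, -, hB, hBε, hrec⟩ := section_exists hT .univ hcons hap hε
  let Bn : ℕ → Set X := fun n => {x | 0 < n ∧ x ∈ B ∧ zp T n x ∈ B ∧ ∀ i : ℕ, 0 < i → i < n →
    zp T i x ∉ B}
  have hm : ∀ n, MeasurableSet (Bn n) := by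
    intro n
    have : Bn n = {x | 0 < n} ∩ (B ∩ (zp T n ⁻¹' B ∩ ⋂ i : ℕ, ⋂ _ : 0 < i, ⋂ _ : i < n,
      (zp T i ⁻¹' B)ᶜ)) := by
      ext x; simp [Bn]
    rw [this]
    exact (MeasurableSet.const _).inter (hB.inter ((zp_measurable T _ hB).inter
      (.iInter fun i => .iInter fun _ => .iInter fun _ => (zp_measurable T _ hB).compl)))
  refine ⟨Bn, hm, ?_, ?_, ?_⟩
  · have key : ∀ (n j n' j' : ℕ), j < n → j' < n' → ∀ x, zp T (-j) x ∈ Bn n →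
        zp T (-j') x ∈ Bn n' → ¬ j < j' := by
      intro n j n' j' hj hj' x hx hx' hlt
      apply hx'.2.2.2 (j' - j) (by omega) (by omega)
      rw [← zp_add]
      convert hx.2.1 using 2
      omega
    have key2 : ∀ (n n' : ℕ) x, x ∈ Bn n → x ∈ Bn n' → ¬ n < n' := by
      intro n n' x hx hx' hlt
      exact hx'.2.2.2 n hx.1 hlt hx.2.2.1
    intro n j n' j' hj hj' x hx hx'
    have h1 := key n j n' j' hj hj' x hx hx'
    have h2 := key n' j' n j hj' hj x hx' hx
    have e : j = j' := by omega
    subst e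
    have h3 := key2 _ _ _ hx hx'
    have h4 := key2 _ _ _ hx' hx
    exact ⟨by omega, rfl⟩
  · filter_upwards [hrec] with x hx
    obtain ⟨⟨m, hm1, hmB⟩, -⟩ := hx trivial 1
    obtain ⟨-, ⟨l, hl1, hlB⟩⟩ := hx trivial 0
    classical
    have h1 : ∃ a : ℕ, 1 ≤ a ∧ zp T a x ∈ B := ⟨m.toNat, by omega, by
      rwa [Int.toNat_of_nonneg (by omega)]⟩
    have h2 : ∃ b : ℕ, zp T (-b) x ∈ B := ⟨(-l).toNat, by
      rwa [Int.toNat_of_nonneg (by omega), neg_neg]⟩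
    refine ⟨Nat.find h1 + Nat.find h2, Nat.find h2, by have := (Nat.find_spec h1).1; omega,
      by have := (Nat.find_spec h1).1; omega, Nat.find_spec h2, ?_, ?_⟩
    · rw [← zp_add]
      convert (Nat.find_spec h1).2 using 2
      push_cast; ring
    · intro i hi hi' hiB
      rw [← zp_add] at hiB
      by_cases hc : i ≤ Nat.find h2
      · refine Nat.find_min h2 (m := Nat.find h2 - i) (by omega) ?_
        convert hiB using 2
        omega
      · refine Nat.find_min h1 (m := i - Nat.find h2) (by omega) ⟨by omega, ?_⟩
        convert hiB using 2
        omega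
  · rw [← measure_iUnion _ hm]
    · exact (measure_mono (iUnion_subset fun n x hx => hx.2.1)).trans hBε.le
    · intro i j hij
      apply Set.disjoint_left.2
      intro x hx hx'
      rcases lt_or_gt_of_ne hij with h | h
      · exact hx'.2.2.2 i hx.1 h hx.2.2.1
      · exact hx.2.2.2 j hx'.1 h hx'.2.2.1

lemma Blk.sum_eq {T : X ≃ᵐ X} (hT : MeasurePreserving T lam lam) {B : ℕ → Set X} {ε : ℝ≥0∞}
    (hB : Blk lam T B ε) : ∑' n : ℕ, n * lam (B n) = lam univ := by
  have h1 : ∀ n : ℕ, n * lam (B n) = ∑' j : ℕ, lam {x | j < n ∧ zp T (-j) x ∈ B n} := by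
    intro n
    rw [tsum_eq_sum (s := Finset.range n)]
    · have : ∀ j ∈ Finset.range n, lam {x | j < n ∧ zp T (-j) x ∈ B n} = lam (B n) := by
        intro j hj
        rw [← (zp_mp T hT (-j)).measure_preimage (hB.meas n).nullMeasurableSet]
        congr 1
        ext x
        simp only [mem_ofPred_eq, mem_preimage, Finset.mem_range.1 hj, true_and]
      rw [Finset.sum_congr rfl this]
      simp
    · intro j hj
      have : ¬ j < n := by simpa using hj
      simp [this]
  simp_rw [h1]
  rw [← ENNReal.tsum_prod (f := fun n j : ℕ => lam {x | j < n ∧ zp T (-j) x ∈ B n}),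
    ← measure_iUnion]
  · apply measure_congr
    filter_upwards [hB.cover] with x ⟨n, j, hj, hx⟩
    apply propext
    exact ⟨fun _ => trivial, fun _ => mem_iUnion.2 ⟨(n, j), hj, hx⟩⟩
  · intro p q hpq
    apply Set.disjoint_left.2
    intro x hx hx'
    obtain ⟨a, b⟩ := hB.disj _ _ _ _ hx.1 hx'.1 x hx.2 hx'.2
    exact hpq (Prod.ext a b)
  · intro p
    exact (MeasurableSet.const _).inter (zp_measurable T _ (hB.meas _))

end P8
end AC

namespace AC
open Filter Topology

section P9
variable [MeasurableSpace X] [StandardBorelSpace X] {lam : Measure X} [SigmaFinite lam]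
  [NullSingletonClass lam]

def Lv (T : X ≃ᵐ X) (C : ℕ → ℕ → ℕ → Set X) (n m h : ℕ) : Set X :=
  zp T (-(h % n : ℕ)) ⁻¹' C n m (h / n)

structure Cut (lam : Measure X) (T : X ≃ᵐ X) (C : ℕ → ℕ → ℕ → Set X) (w : ℕ → ℕ → ℝ≥0∞)
    (ε : ℝ≥0∞) : Prop where
  meas : ∀ n m i, MeasurableSet (C n m i)
  val : ∀ n m i, 0 < n → i < m → lam (C n m i) = w n m
  disj : ∀ n m h n' m' h', 0 < n → 0 < n' → ∀ x, x ∈ Lv T C n m h → x ∈ Lv T C n' m' h' →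
    n = n' ∧ m = m' ∧ h = h'
  cover : ∀ᵐ x ∂lam, ∃ n m h, 0 < n ∧ h < n * m ∧ x ∈ Lv T C n m h
  small : lam {x | ∃ n m h, 0 < n ∧ h % n + 1 = n ∧ x ∈ Lv T C n m h} ≤ ε

lemma cut_exists {T : X ≃ᵐ X} (hT : MeasurePreserving T lam lam) {B : ℕ → Set X} {ε : ℝ≥0∞}
    (hεt : ε ≠ ∞)
    (hB : Blk lam T B ε) (w : ℕ → ℕ → ℝ≥0∞) (hw : ∀ n, 0 < n → ∑' m : ℕ, m * w n m = lam (B n)) :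
    ∃ C, Cut lam T C w ε := by
  have hfin : ∀ n, lam (B n) ≠ ∞ := fun n =>
    ne_top_of_le_ne_top hεt ((ENNReal.le_tsum n).trans hB.small)
  have h1 : ∀ n, ∃ C : ℕ → ℕ → Set X, (∀ m i, MeasurableSet (C m i)) ∧ (∀ m i, C m i ⊆ B n) ∧
      (∀ m i, 0 < n → i < m → lam (C m i) = w n m) ∧
      (∀ m i m' i' x, x ∈ C m i → x ∈ C m' i' → m = m' ∧ i = i') ∧
      ∀ᵐ x ∂lam, x ∈ B n → 0 < n → ∃ m i, i < m ∧ x ∈ C m i := by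
    intro n
    by_cases hn : 0 < n
    · obtain ⟨C, a, b, c, d, e⟩ := partition_pair (hB.meas n) (w n) (hw n hn) (hfin n)
      refine ⟨C, a, b, fun m i _ => c m i, d, ?_⟩
      filter_upwards [e] with x hx h _ using hx h
    · exact ⟨fun _ _ => ∅, fun _ _ => .empty, fun _ _ => empty_subset _, fun _ _ h => absurd h hn,
        fun _ _ _ _ x h => absurd h (notMem_empty x), .of_forall fun x _ h => absurd h hn⟩
  choose C cm cs cv cd cc using h1
  refine ⟨C, cm, fun n m i hn hi => cv n m i hn hi, ?_, ?_, ?_⟩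
  · intro n m h n' m' h' hn hn' x hx hx'
    obtain ⟨e1, e2⟩ := hB.disj n (h % n) n' (h' % n') (Nat.mod_lt _ hn) (Nat.mod_lt _ hn') x
      (cs _ _ _ hx) (cs _ _ _ hx')
    subst e1
    change zp T (-(h % n : ℕ)) x ∈ C n m (h / n) at hx
    change zp T (-(h' % n : ℕ)) x ∈ C n m' (h' / n) at hx'
    rw [← e2] at hx'
    obtain ⟨e3, e4⟩ := cd n _ _ _ _ _ hx hx'
    refine ⟨rfl, e3, ?_⟩
    rw [← Nat.div_add_mod h n, e4, e2, Nat.div_add_mod]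
  · filter_upwards [hB.cover, ae_zp T hT (ae_all_iff.2 cc)] with x ⟨n, j, hj, hx⟩ hc
    obtain ⟨m, i, hi, hxC⟩ := hc (-j) n hx (by omega)
    have e1 : (n * i + j) % n = j := by rw [Nat.mul_add_mod, Nat.mod_eq_of_lt hj]
    have e2 : (n * i + j) / n = i := by
      rw [Nat.mul_add_div (by omega), Nat.div_eq_of_lt hj, add_zero]
    refine ⟨n, m, n * i + j, by omega, ?_, ?_⟩
    · calc n * i + j < n * i + n := by omega
        _ = n * (i + 1) := by ring
        _ ≤ n * m := Nat.mul_le_mul_left _ hi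
    · change zp T (-((n * i + j) % n : ℕ)) x ∈ C n m ((n * i + j) / n)
      rw [e1, e2]; exact hxC
  · calc _ ≤ lam (⋃ n : ℕ, zp T (-(n - 1 : ℤ)) ⁻¹' B n) := by
          apply measure_mono
          rintro x ⟨n, m, h, hn, hh, hx⟩
          refine mem_iUnion.2 ⟨n, ?_⟩
          have := cs _ _ _ hx
          have e : (n : ℤ) - 1 = (h % n : ℕ) := by omega
          rw [mem_preimage, e]
          exact this
      _ ≤ ∑' n : ℕ, lam (zp T (-(n - 1 : ℤ)) ⁻¹' B n) := measure_iUnion_le _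
      _ = ∑' n : ℕ, lam (B n) := by
          congr 1; ext n
          exact (zp_mp T hT _).measure_preimage (hB.meas n).nullMeasurableSet
      _ ≤ ε := hB.small

lemma cut_cl (hX : lam univ ≠ 0) {T₁ T₂ : X ≃ᵐ X} (hT₁ : MeasurePreserving T₁ lam lam)
    (hT₂ : MeasurePreserving T₂ lam lam) {ε : ℝ≥0∞} {w : ℕ → ℕ → ℝ≥0∞}
    {C₁ C₂ : ℕ → ℕ → ℕ → Set X} (h₁ : Cut lam T₁ C₁ w ε)
    (h₂ : Cut lam T₂ C₂ (fun m n => w n m) ε) : Cl lam T₁ T₂ (ε + ε) := by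
  have hne : NeZero lam := ⟨fun h => hX (by simp [h])⟩
  obtain ⟨x₀, n₀, m₀, k₀, hn₀, hk₀, -⟩ := h₁.cover.exists
  have hXne : Nonempty X := ⟨x₀⟩
  let ι := {q : ℕ × ℕ × ℕ // q.2.2 < q.1 * q.2.1}
  have hι : Nonempty ι := ⟨⟨(n₀, m₀, k₀), hk₀⟩⟩
  have pos1 : ∀ i : ι, 0 < i.1.1 := fun i =>
    Nat.pos_of_ne_zero fun h => by have := i.2; rw [h, zero_mul] at this; omega
  have pos2 : ∀ i : ι, 0 < i.1.2.1 := fun i =>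
    Nat.pos_of_ne_zero fun h => by have := i.2; rw [h, mul_zero] at this; omega
  -- isos to the reference
  have iso1 : ∀ n m i, ∃ (f g : X → X), 0 < n → 0 < m → i < m →
      MeasurePreserving f (lam.restrict (C₁ n m i)) (lam.restrict (C₁ n m 0)) ∧
      MeasurePreserving g (lam.restrict (C₁ n m 0)) (lam.restrict (C₁ n m i)) ∧
      (∀ᵐ x ∂lam.restrict (C₁ n m i), g (f x) = x) ∧
      ∀ᵐ x ∂lam.restrict (C₁ n m 0), f (g x) = x := by
    intro n m i
    by_cases h : 0 < n ∧ 0 < m ∧ i < m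
    · obtain ⟨f, g, h1⟩ := iso' (lam.restrict (C₁ n m i)) (lam.restrict (C₁ n m 0))
        (by simp only [Measure.restrict_apply_univ]
            rw [h₁.val _ _ _ h.1 h.2.2, h₁.val _ _ _ h.1 h.2.1])
      exact ⟨f, g, fun _ _ _ => h1⟩
    · exact ⟨id, id, fun a b c => absurd ⟨a, b, c⟩ h⟩
  have iso2 : ∀ n m i, ∃ (f g : X → X), 0 < n → 0 < m → i < n →
      MeasurePreserving f (lam.restrict (C₂ m n i)) (lam.restrict (C₁ n m 0)) ∧
      MeasurePreserving g (lam.restrict (C₁ n m 0)) (lam.restrict (C₂ m n i)) ∧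
      (∀ᵐ x ∂lam.restrict (C₂ m n i), g (f x) = x) ∧
      ∀ᵐ x ∂lam.restrict (C₁ n m 0), f (g x) = x := by
    intro n m i
    by_cases h : 0 < n ∧ 0 < m ∧ i < n
    · obtain ⟨f, g, h1⟩ := iso' (lam.restrict (C₂ m n i)) (lam.restrict (C₁ n m 0))
        (by simp only [Measure.restrict_apply_univ]
            rw [h₂.val _ _ _ h.2.1 h.2.2, h₁.val _ _ _ h.1 h.2.1])
      exact ⟨f, g, fun _ _ _ => h1⟩
    · exact ⟨id, id, fun a b c => absurd ⟨a, b, c⟩ h⟩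
  choose f₁ g₁ hi₁ using iso1
  choose f₂ g₂ hi₂ using iso2
  have q1 : ∀ i : ι, i.1.2.2 / i.1.1 < i.1.2.1 := fun i => Nat.div_lt_of_lt_mul i.2
  have q2 : ∀ i : ι, i.1.2.2 / i.1.2.1 < i.1.1 := fun i =>
    Nat.div_lt_of_lt_mul (by rw [mul_comm]; exact i.2)
  have hi₁' := fun i : ι => hi₁ i.1.1 i.1.2.1 (i.1.2.2 / i.1.1) (pos1 i) (pos2 i) (q1 i)
  have hi₂' := fun i : ι => hi₂ i.1.1 i.1.2.1 (i.1.2.2 / i.1.2.1) (pos1 i) (pos2 i) (q2 i)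
  let φ : ι → X → X := fun i x => zp T₂ (i.1.2.2 % i.1.2.1 : ℕ)
    (g₂ i.1.1 i.1.2.1 (i.1.2.2 / i.1.2.1) (f₁ i.1.1 i.1.2.1 (i.1.2.2 / i.1.1)
      (zp T₁ (-(i.1.2.2 % i.1.1 : ℕ)) x)))
  let ψ : ι → X → X := fun i x => zp T₁ (i.1.2.2 % i.1.1 : ℕ)
    (g₁ i.1.1 i.1.2.1 (i.1.2.2 / i.1.1) (f₂ i.1.1 i.1.2.1 (i.1.2.2 / i.1.2.1)
      (zp T₂ (-(i.1.2.2 % i.1.2.1 : ℕ)) x)))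
  let U : ι → Set X := fun i => Lv T₁ C₁ i.1.1 i.1.2.1 i.1.2.2
  let V : ι → Set X := fun i => Lv T₂ C₂ i.1.2.1 i.1.1 i.1.2.2
  have hVm : ∀ i, MeasurableSet (V i) := fun i => zp_measurable _ _ (h₂.meas _ _ _)
  have d1 : ∀ i : ι, MeasurePreserving (zp T₁ (-(i.1.2.2 % i.1.1 : ℕ))) (lam.restrict (U i))
      (lam.restrict (C₁ i.1.1 i.1.2.1 (i.1.2.2 / i.1.1))) := fun i =>
    (zp_mp T₁ hT₁ _).restrict_preimage (h₁.meas _ _ _)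
  have u2 : ∀ i : ι, MeasurePreserving (zp T₂ (i.1.2.2 % i.1.2.1 : ℕ))
      (lam.restrict (C₂ i.1.2.1 i.1.1 (i.1.2.2 / i.1.2.1))) (lam.restrict (V i)) := by
    intro i
    have := (zp_mp T₂ hT₂ (i.1.2.2 % i.1.2.1 : ℕ)).restrict_preimage (hVm i)
    have e : zp T₂ (i.1.2.2 % i.1.2.1 : ℕ) ⁻¹' V i =
        C₂ i.1.2.1 i.1.1 (i.1.2.2 / i.1.2.1) := by
      ext x; simp only [V, Lv, mem_preimage, zp_neg_zp]
    rwa [e] at this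
  have hmp : ∀ i, MeasurePreserving (φ i) (lam.restrict (U i)) (lam.restrict (V i)) := fun i =>
    (u2 i).comp ((hi₂' i).2.1.comp ((hi₁' i).1.comp (d1 i)))
  obtain ⟨S, hS, hSφ⟩ := glue lam hX U V
    (fun i => zp_measurable _ _ (h₁.meas _ _ _)) hVm
    (fun i i' hii => by
      apply Set.disjoint_left.2
      intro x hx hx'
      obtain ⟨a, b, c⟩ := h₁.disj _ _ _ _ _ _ (pos1 i) (pos1 i') x hx hx'
      exact hii (Subtype.ext (Prod.ext a (Prod.ext b c))))
    (fun i i' hii => by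
      apply Set.disjoint_left.2
      intro x hx hx'
      obtain ⟨a, b, c⟩ := h₂.disj _ _ _ _ _ _ (pos2 i) (pos2 i') x hx hx'
      exact hii (Subtype.ext (Prod.ext b (Prod.ext a c))))
    (by
      filter_upwards [h₁.cover] with x ⟨n, m, h, hn, hh, hx⟩
      exact ⟨⟨(n, m, h), hh⟩, hx⟩)
    (by
      filter_upwards [h₂.cover] with x ⟨n, m, h, hn, hh, hx⟩
      exact ⟨⟨(m, n, h), by rw [mul_comm]; exact hh⟩, hx⟩)
    φ ψ
    (fun i => (zp_measurable _ _).comp ((hi₁' i).2.1.measurable.comp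
      ((hi₂' i).1.measurable.comp (zp_measurable _ _))))
    (fun i => (zp_measurable _ _).comp ((hi₂' i).2.1.measurable.comp
      ((hi₁' i).1.measurable.comp (zp_measurable _ _))))
    hmp
    (fun i => by
      have e1 := (d1 i).quasiMeasurePreserving.ae (hi₁' i).2.2.1
      have e2 := (d1 i).quasiMeasurePreserving.ae
        ((hi₁' i).1.quasiMeasurePreserving.ae (hi₂' i).2.2.2)
      filter_upwards [e1, e2] with x h1 h2
      simp only [ψ, φ]
      rw [zp_neg_zp, h2, h1, zp_zp_neg])
  have hSV : ∀ᵐ x ∂lam, ∀ i, x ∈ U i → φ i x ∈ V i := by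
    rw [ae_all_iff]; intro i
    exact (ae_restrict_iff' (zp_measurable _ _ (h₁.meas _ _ _))).1
      ((hmp i).quasiMeasurePreserving.ae (ae_restrict_mem (hVm i)))
  refine ⟨S, hS, ?_⟩
  set E₁ := {x | ∃ n m h, 0 < n ∧ h % n + 1 = n ∧ x ∈ Lv T₁ C₁ n m h} with hE₁
  set E₂ := {x | ∃ n m h, 0 < n ∧ h % n + 1 = n ∧ x ∈ Lv T₂ C₂ n m h} with hE₂
  have hsub : lam {y | S (T₁ y) ≠ T₂ (S y)} ≤ lam (E₁ ∪ S ⁻¹' E₂) := by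
    apply measure_mono_ae
    filter_upwards [hSφ, hT₁.quasiMeasurePreserving.ae hSφ, hSV, h₁.cover]
      with x a1 a2 a3 ⟨n, m, h, hn, hh, hx⟩ hbad
    by_contra hcon
    have hcon : ¬ (x ∈ E₁ ∨ S x ∈ E₂) := hcon
    rw [not_or] at hcon
    apply hbad
    have hm : 0 < m := pos2 ⟨(n, m, h), hh⟩
    have b1 := a1 ⟨(n, m, h), hh⟩ hx
    have b3 := a3 ⟨(n, m, h), hh⟩ hx
    rw [← b1] at b3
    have c1 : h % n + 1 < n := by
      have := Nat.mod_lt h hn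
      have h' : h % n + 1 ≠ n := fun e => hcon.1 ⟨n, m, h, hn, e, hx⟩
      omega
    have c2 : h % m + 1 < m := by
      have := Nat.mod_lt h hm
      have h' : h % m + 1 ≠ m := fun e => hcon.2 ⟨m, n, h, hm, e, b3⟩
      omega
    have key : ∀ k : ℕ, h % k + 1 < k → (h + 1) % k = h % k + 1 ∧ (h + 1) / k = h / k := by
      intro k hk
      have e : h + 1 = k * (h / k) + (h % k + 1) := by
        have := Nat.div_add_mod h k; omega
      constructor
      · conv_lhs => rw [e]
        rw [Nat.mul_add_mod, Nat.mod_eq_of_lt hk]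
      · conv_lhs => rw [e]
        rw [Nat.mul_add_div (by omega), Nat.div_eq_of_lt hk, add_zero]
    obtain ⟨k1, k2⟩ := key n c1
    obtain ⟨k3, k4⟩ := key m c2
    have hh1 : h + 1 < n * m := by
      have e : (h + 1) / n < m := by rw [k2]; exact q1 ⟨(n, m, h), hh⟩
      have := (Nat.div_lt_iff_lt_mul hn).1 e
      rwa [mul_comm] at this
    have ez : zp T₁ (-(h % n + 1 : ℕ)) (T₁ x) = zp T₁ (-(h % n : ℕ)) x := by
      rw [← zp_succ']; congr 1; push_cast; ring
    have hx1 : T₁ x ∈ Lv T₁ C₁ n m (h + 1) := by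
      change zp T₁ (-((h + 1) % n : ℕ)) (T₁ x) ∈ C₁ n m ((h + 1) / n)
      rw [k1, k2, ez]; exact hx
    have b2 := a2 ⟨(n, m, h + 1), hh1⟩ hx1
    simp only [φ] at b1 b2
    rw [b1, b2, k1, k2, k3, k4, ez, Nat.cast_succ, zp_succ]
  refine hsub.trans ((measure_union_le _ _).trans ?_)
  rw [hS.measure_preimage_equiv]
  exact add_le_add h₁.small h₂.small

lemma caseB (hX : lam univ = ∞) {T₁ T₂ : X ≃ᵐ X} (hT₁ : MeasurePreserving T₁ lam lam)
    (hT₂ : MeasurePreserving T₂ lam lam) (hap₁ : Aperiodic lam T₁) (hap₂ : Aperiodic lam T₂)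
    (hc₁ : ConservativeOn lam T₁ univ) (hc₂ : ConservativeOn lam T₂ univ) {ε : ℝ≥0∞}
    (hε : 0 < ε) (hεt : ε ≠ ∞) : Cl lam T₁ T₂ (ε + ε) := by
  obtain ⟨B₁, hB₁⟩ := blk_exists hT₁ hap₁ hc₁ hε
  obtain ⟨B₂, hB₂⟩ := blk_exists hT₂ hap₂ hc₂ hε
  have hf : ∀ {T : X ≃ᵐ X} {B : ℕ → Set X}, Blk lam T B ε → ∀ n : ℕ, (n : ℝ≥0∞) * lam (B n) ≠ ∞ :=
    fun hB n => ENNReal.mul_ne_top (by finiteness)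
      (ne_top_of_le_ne_top hεt ((ENNReal.le_tsum n).trans hB.small))
  obtain ⟨μ, hμ1, hμ2⟩ := matrix_exists (fun n => n * lam (B₁ n)) (fun n => n * lam (B₂ n))
    (hf hB₁) (hf hB₂) ((hB₁.sum_eq hT₁).trans (hB₂.sum_eq hT₂).symm)
  have z1 : ∀ m, μ 0 m = 0 := by
    have := hμ1 0
    simpa using this
  have z2 : ∀ n, μ n 0 = 0 := by
    have := hμ2 0
    simpa using this
  let w : ℕ → ℕ → ℝ≥0∞ := fun n m => (n : ℝ≥0∞)⁻¹ * (m : ℝ≥0∞)⁻¹ * μ n m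
  obtain ⟨C₁, hC₁⟩ := cut_exists hT₁ hεt hB₁ w (by
    intro n hn
    have : ∀ m : ℕ, m * w n m = (n : ℝ≥0∞)⁻¹ * μ n m := by
      intro m
      rcases Nat.eq_zero_or_pos m with h | h
      · subst h; simp [z2]
      · simp only [w]
        rw [mul_comm (n : ℝ≥0∞)⁻¹, mul_assoc, ← mul_assoc,
          ENNReal.mul_inv_cancel (by simp; omega) (by finiteness), one_mul]
    simp_rw [this]
    rw [ENNReal.tsum_mul_left, hμ1, ← mul_assoc,
      ENNReal.inv_mul_cancel (by simp; omega) (by finiteness), one_mul])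
  obtain ⟨C₂, hC₂⟩ := cut_exists hT₂ hεt hB₂ (fun m n => w n m) (by
    intro m hm
    have : ∀ n : ℕ, n * w n m = (m : ℝ≥0∞)⁻¹ * μ n m := by
      intro n
      rcases Nat.eq_zero_or_pos n with h | h
      · subst h; simp [z1]
      · simp only [w]
        rw [mul_assoc, ← mul_assoc,
          ENNReal.mul_inv_cancel (by simp; omega) (by finiteness), one_mul]
    simp_rw [this]
    rw [ENNReal.tsum_mul_left, hμ2, ← mul_assoc,
      ENNReal.inv_mul_cancel (by simp; omega) (by finiteness), one_mul])
  exact cut_cl (by simp [hX]) hT₁ hT₂ hC₁ hC₂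

lemma cons_univ {T : X ≃ᵐ X} (hT : MeasurePreserving T lam lam) {c d D : Set X}
    (hc : MeasurableSet c)
    (hcover : c ∪ d = univ) (hcons : ConservativeOn lam T c) (hfd : IsFundDomOn lam T d D)
    (h0 : lam D = 0) : ConservativeOn lam T univ := by
  have hd : ∀ᵐ x ∂lam, x ∈ c := by
    filter_upwards [fd_cover hfd, ae_zp T hT (measure_eq_zero_iff_ae_notMem.1 h0)] with x h1 h2
    have : x ∈ c ∪ d := hcover ▸ mem_univ x
    rcases this with h | h
    · exact h
    · obtain ⟨n, hn⟩ := h1 h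
      exact absurd hn (h2 n)
  intro A _ hA hpos
  have e : lam (A ∩ c) = lam A := by
    apply measure_congr
    filter_upwards [hd] with x hx
    exact propext ⟨fun h => h.1, fun h => ⟨h, hx⟩⟩
  filter_upwards [hcons (A ∩ c) inter_subset_right (hA.inter hc) (e ▸ hpos), hd] with x h1 h2 hxA
  obtain ⟨n, hn, h⟩ := h1 ⟨hxA, h2⟩
  exact ⟨n, hn, h.1⟩

end P9
end AC

theorem approx_conj_iff_fund_dom_measure_eq
    [MeasurableSpace X] [StandardBorelSpace X]
    (lam : Measure X) [SigmaFinite lam] [NullSingletonClass lam] (hX : lam univ = ∞)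
    (T₁ T₂ : X ≃ᵐ X)
    (hT₁ : MeasurePreserving (⇑T₁) lam lam) (hT₂ : MeasurePreserving (⇑T₂) lam lam)
    (hap₁ : Aperiodic lam T₁) (hap₂ : Aperiodic lam T₂)
    (c₁ d₁ D₁ c₂ d₂ D₂ : Set X)
    (hc₁ : MeasurableSet c₁) (hd₁ : MeasurableSet d₁) (hD₁ : MeasurableSet D₁)
    (hc₂ : MeasurableSet c₂) (hd₂ : MeasurableSet d₂) (hD₂ : MeasurableSet D₂)
    (hdisj₁ : Disjoint c₁ d₁) (hcover₁ : c₁ ∪ d₁ = univ)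
    (hdisj₂ : Disjoint c₂ d₂) (hcover₂ : c₂ ∪ d₂ = univ)
    (hinv₁c : ⇑T₁ '' c₁ = c₁) (hinv₁d : ⇑T₁ '' d₁ = d₁)
    (hinv₂c : ⇑T₂ '' c₂ = c₂) (hinv₂d : ⇑T₂ '' d₂ = d₂)
    (hcons₁ : ConservativeOn lam T₁ c₁) (hcons₂ : ConservativeOn lam T₂ c₂)
    (hfd₁ : IsFundDomOn lam T₁ d₁ D₁) (hfd₂ : IsFundDomOn lam T₂ d₂ D₂)
    (hempty₁ : lam d₁ = 0 → D₁ = ∅) (hempty₂ : lam d₂ = 0 → D₂ = ∅) :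
    ApproxConj lam T₁ T₂ ↔ lam D₁ = lam D₂ := by
  have hX0 : lam univ ≠ 0 := by simp [hX]
  constructor
  · intro h
    have h1 := AC.cl_of_approxConj h
    exact le_antisymm
      (AC.forward_le hT₁ hT₂ hD₁ hfd₁ hc₂ hD₂ hcover₂ hcons₂ hfd₂ h1)
      (AC.forward_le hT₂ hT₁ hD₂ hfd₂ hc₁ hD₁ hcover₁ hcons₁ hfd₁ fun ε hε => (h1 ε hε).symm)
  · intro h
    apply AC.approxConj_of_cl
    by_cases h0 : lam D₁ = 0
    · intro ε hε
      obtain ⟨δ, hδ, hδε⟩ := exists_between (ENNReal.half_pos hε.ne')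
      have h1 := AC.caseB hX hT₁ hT₂ hap₁ hap₂
        (AC.cons_univ hT₁ hc₁ hcover₁ hcons₁ hfd₁ h0)
        (AC.cons_univ hT₂ hc₂ hcover₂ hcons₂ hfd₂ (h ▸ h0)) hδ hδε.ne_top
      obtain ⟨S, hS, h2⟩ := h1
      refine ⟨S, hS, h2.trans ?_⟩
      calc δ + δ ≤ ε / 2 + ε / 2 := add_le_add hδε.le hδε.le
        _ = ε := ENNReal.add_halves ε
    · intro ε hε
      have h0' : 0 < lam D₁ := pos_iff_ne_zero.2 h0
      obtain ⟨T₁', D₁', a1, a2, a3, a4, a5, a6⟩ := AC.caseA_one hX0 hT₁ hap₁ hc₁ hD₁ hdisj₁ hcover₁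
        hinv₁c hcons₁ hfd₁ h0' (ENNReal.half_pos hε.ne')
      obtain ⟨T₂', D₂', b1, b2, b3, b4, b5, b6⟩ := AC.caseA_one hX0 hT₂ hap₂ hc₂ hD₂ hdisj₂ hcover₂
        hinv₂c hcons₂ hfd₂ (h ▸ h0') (ENNReal.half_pos hε.ne')
      have hm := AC.caseA_conj hX0 a1 b1 a2 b2 (a3.trans (h.trans b3.symm)) a4 b4 a5 b5
      have := ((AC.cl_near a6).trans hm).trans (AC.cl_near b6).symm
      rwa [add_zero, ENNReal.add_halves] at this
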